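/- arXiv:2406.09697 — 6 statements merged into one kernel-verified Lean document; each statement's English description precedes it below -/
import Mathlib

section
/- Let k and ℓ be positive even integers and set n = k + ℓ. If there exists a Seidel matrix of order k with determinant d₁² and a Seidel matrix of order ℓ with determinant d₂² (d₁, d₂ natural numbers), then there exists a Seidel matrix of order n with determinant (d₁·d₂)². In particular, for every positive even integer n, every value that occurs as the determinant of a Seidel matrix of order n also occurs as the determinant of a Seidel matrix of order n+2. -/
open Matrix

/-- A Seidel matrix: zero diagonal, off-diagonal entries `±1`, skew-symmetric. -/
def IsSeidel {n : ℕ} (S : Matrix (Fin n) (Fin n) ℤ) : Prop :=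
  (∀ i, S i i = 0) ∧ (∀ i j, i ≠ j → S i j = 1 ∨ S i j = -1) ∧ Sᵀ = -S

/-- The quadratic form of a skew-symmetric matrix vanishes. -/
lemma dotProduct_mulVec_self_of_transpose_eq_neg {m : Type*} [Fintype m] {A : Matrix m m ℚ}
    (hA : Aᵀ = -A) (u : m → ℚ) : u ⬝ᵥ A *ᵥ u = 0 := by
  have h : u ⬝ᵥ A *ᵥ u = -(u ⬝ᵥ A *ᵥ u) := by
    conv_lhs => rw [dotProduct_mulVec, ← mulVec_transpose, hA, neg_mulVec, neg_dotProduct,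
      dotProduct_comm]
  linarith

/-- Gluing a nonsingular skew-symmetric matrix to another matrix along rank-one off-diagonal
blocks multiplies the determinants. -/
lemma det_fromBlocks_vecMulVec {m n : Type*} [Fintype m] [DecidableEq m] [Fintype n]
    [DecidableEq n] {A : Matrix m m ℚ} (B : Matrix n n ℚ) (hA : Aᵀ = -A) (hdet : A.det ≠ 0)
    (u : m → ℚ) (v : n → ℚ) :
    (fromBlocks A (vecMulVec u v) (-vecMulVec v u) B).det = A.det * B.det := by
  have hunit : IsUnit A.det := hdet.isUnit
  let := A.invertibleOfIsUnitDet hunit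
  have hinv : (A⁻¹)ᵀ = -A⁻¹ := by
    rw [transpose_nonsing_inv, hA]
    refine inv_eq_right_inv ?_
    rw [neg_mul_neg, mul_nonsing_inv _ hunit]
  have hzero : vecMulVec v u * A⁻¹ * vecMulVec u v = 0 := by
    rw [Matrix.mul_assoc, mul_vecMulVec, vecMulVec_mul_vecMulVec,
      dotProduct_mulVec_self_of_transpose_eq_neg hinv, zero_smul, vecMulVec_zero]
  rw [det_fromBlocks₁₁, invOf_eq_nonsing_inv, Matrix.neg_mul, Matrix.neg_mul, hzero, neg_zero,
    sub_zero]

/-- A Seidel matrix of even order is nonsingular, since modulo two it is an involution. -/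
lemma IsSeidel.det_ne_zero {n : ℕ} {S : Matrix (Fin n) (Fin n) ℤ} (hS : IsSeidel S)
    (hn : Even n) : S.det ≠ 0 := by
  intro h0
  set f := Int.castRingHom (ZMod 2)
  have hmap : S.map f = vecMulVec 1 1 - 1 := by
    ext i j
    rcases eq_or_ne i j with rfl | hij
    · simp [hS.1]
    · rcases hS.2.1 i j hij with h | h <;> simp [h, hij]
  have hcard : (n : ZMod 2) = 0 := (ZMod.natCast_eq_zero_iff_even).2 hn
  have hJ : vecMulVec (1 : Fin n → ZMod 2) (1 : Fin n → ZMod 2) * vecMulVec 1 1 = 0 := by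
    rw [vecMulVec_mul_vecMulVec]
    simp [hcard]
  have hsq : S.map f * S.map f = 1 := by
    rw [hmap, sub_mul, mul_sub, hJ, mul_one, one_mul, zero_sub, ← neg_add', sub_eq_add_neg]
    ext i j
    have h2 : (2 : ZMod 2) = 0 := rfl
    simp only [Matrix.add_apply, Matrix.neg_apply, vecMulVec_apply, Pi.one_apply]
    linear_combination -h2
  have hdet := congrArg det hsq
  have hf : (S.map f).det = 0 := by
    rw [← RingHom.mapMatrix_apply, ← RingHom.map_det, h0, map_zero]
  rw [det_mul, hf, det_one, mul_zero] at hdet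
  exact zero_ne_one hdet

/-- Two Seidel matrices, the first of even order, combine into one whose determinant is the
product of the two determinants. -/
lemma IsSeidel.exists_det_eq_mul {k l : ℕ} {S₁ : Matrix (Fin k) (Fin k) ℤ}
    {S₂ : Matrix (Fin l) (Fin l) ℤ} (h₁ : IsSeidel S₁) (h₂ : IsSeidel S₂) (hk : Even k) :
    ∃ S : Matrix (Fin (k + l)) (Fin (k + l)) ℤ, IsSeidel S ∧ S.det = S₁.det * S₂.det := by
  set M := fromBlocks S₁ (vecMulVec 1 1) (-vecMulVec 1 1) S₂ with hM
  refine ⟨reindex finSumFinEquiv finSumFinEquiv M, ⟨fun i => ?_, fun i j => ?_, ?_⟩, ?_⟩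
  · obtain ⟨a, rfl⟩ := finSumFinEquiv.surjective i
    rcases a with a | a
    · simpa [M] using h₁.1 a
    · simpa [M] using h₂.1 a
  · obtain ⟨a, rfl⟩ := finSumFinEquiv.surjective i
    obtain ⟨b, rfl⟩ := finSumFinEquiv.surjective j
    rw [finSumFinEquiv.injective.ne_iff, reindex_apply, submatrix_apply, Equiv.symm_apply_apply,
      Equiv.symm_apply_apply]
    rcases a with a | a <;> rcases b with b | b <;> intro hab
    · exact h₁.2.1 a b fun h => hab (by rw [h])
    · simp [M]
    · simp [M]
    · exact h₂.2.1 a b fun h => hab (by rw [h])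
  · have hMt : Mᵀ = -M := by
      rw [hM, fromBlocks_transpose, fromBlocks_neg, h₁.2.2, h₂.2.2, transpose_neg,
        transpose_vecMulVec, transpose_vecMulVec, neg_neg]
    rw [transpose_reindex, hMt]
    rfl
  · rw [det_reindex_self]
    set f := Int.castRingHom ℚ
    have hA : (S₁.map f)ᵀ = -S₁.map f := by
      rw [← transpose_map, h₁.2.2]
      ext
      simp
    have hdet (n : ℕ) (A : Matrix (Fin n) (Fin n) ℤ) : (A.map f).det = (A.det : ℚ) :=
      (RingHom.map_det f A).symm
    have hMmap : M.map f =
        fromBlocks (S₁.map f) (vecMulVec 1 1) (-vecMulVec 1 1) (S₂.map f) := by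
      rw [hM, fromBlocks_map]
      congr 1 <;> ext <;> simp [vecMulVec_apply]
    have hprod := det_fromBlocks_vecMulVec (S₂.map f) hA
      (by rw [hdet]; exact_mod_cast h₁.det_ne_zero hk) 1 1
    rw [← hMmap, hdet, hdet, show (M.map f).det = (M.det : ℚ) from (RingHom.map_det f M).symm]
      at hprod
    exact_mod_cast hprod

/-- The Seidel matrix of order two with determinant one. -/
lemma isSeidel_two : IsSeidel !![0, 1; -1, 0] := by
  refine ⟨by decide, fun i j hij => ?_, ?_⟩
  · fin_cases i <;> fin_cases j <;> simp_all
  · ext i j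
    fin_cases i <;> fin_cases j <;> rfl

/-- If `k, ℓ` are positive even integers and `d₁² ∈ det D(k)`,
`d₂² ∈ det D(ℓ)`, then some Seidel matrix of order `k + ℓ` has determinant
`(d₁·d₂)²`.  In particular `D(n) ⊆ D(n+2)` for every positive even `n`. -/
theorem seidel_det_mul_closed :
    (∀ k ℓ : ℕ, 0 < k → 0 < ℓ → Even k → Even ℓ → ∀ d₁ d₂ : ℕ,
      (∃ S₁ : Matrix (Fin k) (Fin k) ℤ, IsSeidel S₁ ∧ S₁.det = ((d₁ : ℤ)) ^ 2) →
      (∃ S₂ : Matrix (Fin ℓ) (Fin ℓ) ℤ, IsSeidel S₂ ∧ S₂.det = ((d₂ : ℤ)) ^ 2) →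
      ∃ S : Matrix (Fin (k + ℓ)) (Fin (k + ℓ)) ℤ, IsSeidel S ∧
        S.det = ((d₁ * d₂ : ℕ) : ℤ) ^ 2) ∧
    (∀ n : ℕ, 0 < n → Even n → ∀ d : ℕ,
      (∃ S : Matrix (Fin n) (Fin n) ℤ, IsSeidel S ∧ S.det = ((d : ℤ)) ^ 2) →
      ∃ S' : Matrix (Fin (n + 2)) (Fin (n + 2)) ℤ, IsSeidel S' ∧
        S'.det = ((d : ℤ)) ^ 2) := by
  have hmul (k l : ℕ) (hk : Even k) (d₁ d₂ : ℕ)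
      (h₁ : ∃ S₁ : Matrix (Fin k) (Fin k) ℤ, IsSeidel S₁ ∧ S₁.det = (d₁ : ℤ) ^ 2)
      (h₂ : ∃ S₂ : Matrix (Fin l) (Fin l) ℤ, IsSeidel S₂ ∧ S₂.det = (d₂ : ℤ) ^ 2) :
      ∃ S : Matrix (Fin (k + l)) (Fin (k + l)) ℤ, IsSeidel S ∧
        S.det = ((d₁ * d₂ : ℕ) : ℤ) ^ 2 := by
    obtain ⟨S₁, hS₁, hd₁⟩ := h₁
    obtain ⟨S₂, hS₂, hd₂⟩ := h₂
    obtain ⟨S, hS, hd⟩ := hS₁.exists_det_eq_mul hS₂ hk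
    exact ⟨S, hS, by rw [hd, hd₁, hd₂, Nat.cast_mul, mul_pow]⟩
  refine ⟨fun k l _ _ hk _ => hmul k l hk, fun n _ hn d h => ?_⟩
  simpa using hmul n 2 hn d 1 h ⟨_, isSeidel_two, by simp [det_fin_two]⟩
end

section
/- For each even positive integer n and each odd positive integer k with k ≤ n²/2 + 1, there exists a Seidel matrix of order n+2 whose determinant equals k². -/
open Matrix

/-- The sign of `j - i`. -/
def natSign (i j : ℕ) : ℤ := if i < j then 1 else if j < i then -1 else 0

/-- The skew-symmetric matrix of the transitive tournament. -/
def transMatrix (n : ℕ) : Matrix (Fin n) (Fin n) ℤ := of fun i j => natSign i j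

/-- The inverse of `transMatrix n` for even `n`. -/
def transInv (n : ℕ) : Matrix (Fin n) (Fin n) ℤ :=
  of fun i j => (-1) ^ (i : ℕ) * natSign j i * (-1) ^ (j : ℕ) * (-1)

lemma natSign_swap (i j : ℕ) : natSign i j = -natSign j i := by
  unfold natSign; split_ifs <;> omega

lemma natSign_sum (j N : ℕ) :
    ∑ i ∈ Finset.range N, natSign i j = if N ≤ j then (N : ℤ) else 2 * j + 1 - N := by
  induction N with
  | zero => simp
  | succ N ih =>
    rw [Finset.sum_range_succ, ih]
    unfold natSign
    split_ifs <;> push_cast <;> omega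

lemma natSign_mul_sum (i k N : ℕ) :
    ∑ j ∈ Finset.range N, natSign i j * natSign j k * (-1) ^ j =
      if N ≤ min i k then -(if Even N then 0 else 1)
      else if N ≤ max i k then (if Even N then 0 else 1) - 1
      else (if i = k then (-1) ^ i else 0) - (if Even N then 0 else 1) := by
  induction N with
  | zero => simp
  | succ N ih =>
    rw [Finset.sum_range_succ, ih]
    have hparity (m : ℕ) (h : ¬ Even m) : (-1 : ℤ) ^ m = -1 :=
      (Nat.not_even_iff_odd.mp h).neg_one_pow
    unfold natSign
    rcases lt_trichotomy i N with hi | hi | hi <;> rcases lt_trichotomy N k with hk | hk | hk <;>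
    rcases lt_trichotomy i k with hik | hik | hik <;> try omega
    all_goals
      simp (disch := omega) only [if_pos, if_neg, Nat.even_add_one]
      split_ifs with h <;> simp [h, hi, hparity, sub_eq_add_neg]

lemma neg_one_pow_mul_self (i : ℕ) : (-1 : ℤ) ^ i * (-1) ^ i = 1 := by
  rw [← mul_pow]; simp

lemma transMatrix_mul_transInv {n : ℕ} (hn : Even n) : transMatrix n * transInv n = 1 := by
  ext i k
  have key : (transMatrix n * transInv n) i k =
      (∑ j ∈ Finset.range n, natSign i j * natSign j k * (-1) ^ j) * (-1) ^ (k : ℕ) := by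
    rw [← Fin.sum_univ_eq_sum_range (fun j => natSign i j * natSign j k * (-1) ^ j),
      mul_apply, Finset.sum_mul]
    refine Finset.sum_congr rfl fun j _ => ?_
    simp only [transMatrix, transInv, of_apply]
    rw [natSign_swap k j]
    ring
  rw [key, natSign_mul_sum, if_neg (by omega), if_neg (by omega), if_pos hn, one_apply]
  by_cases h : i = k
  · subst h; simp [neg_one_pow_mul_self]
  · simp [h, Fin.val_inj]

lemma transpose_transInv (n : ℕ) : (transInv n)ᵀ = -transInv n := by
  ext i j
  simp only [transInv, transpose_apply, of_apply, neg_apply]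
  rw [natSign_swap i j]; ring

lemma skew_dotProduct {ι : Type*} [Fintype ι] {A : Matrix ι ι ℤ} (hA : Aᵀ = -A) (v : ι → ℤ) :
    v ⬝ᵥ A *ᵥ v = 0 := by
  have h : v ⬝ᵥ A *ᵥ v = -(v ⬝ᵥ A *ᵥ v) := by
    conv_lhs => rw [dotProduct_mulVec, ← mulVec_transpose, hA, neg_mulVec, neg_dotProduct,
      dotProduct_comm]
  omega

lemma det_transMatrix {n : ℕ} (hn : Even n) : (transMatrix n).det = 1 := by
  have hinv := transMatrix_mul_transInv hn
  have hu : IsUnit (transMatrix n).det := isUnit_det_of_right_inverse hinv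
  have hT : (transMatrix n)⁻¹ = transInv n := inv_eq_right_inv hinv
  have h1 := det_add_replicateCol_mul_replicateRow (ι := Unit) hu (fun _ => 1) (fun _ => 1)
  have h2 : (transMatrix n + replicateCol Unit (fun _ => (1 : ℤ)) *
      replicateRow Unit (fun _ => (1 : ℤ))).det = 1 := by
    rw [det_of_isUpperTriangular]
    · simp [mul_apply, transMatrix, natSign]
    · intro i j hij
      have hji : j < i := hij
      simp [mul_apply, transMatrix, natSign, hji, hji.not_gt]
  rw [h2, hT] at h1
  have h3 := skew_dotProduct (transpose_transInv n) (fun _ => 1)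
  have h4 : (1 + replicateRow Unit (fun _ : Fin n => (1 : ℤ)) * (transInv n) *
      replicateCol Unit (fun _ : Fin n => (1 : ℤ)) : Matrix Unit Unit ℤ).det = 1 := by
    rw [det_unique, Matrix.add_apply, Matrix.mul_assoc]
    simp only [one_apply_eq]
    simpa [mul_apply, dotProduct, mulVec] using h3
  rw [h4, mul_one] at h1
  exact h1.symm

lemma exists_signs_sum_eq (m : ℕ) : ∀ t : ℤ, |t| ≤ (m : ℤ) ^ 2 →
    ∃ y : ℕ → ℤ, (∀ j, y j = 1 ∨ y j = -1) ∧
      ∑ j ∈ Finset.range (2 * m), y j * (2 * j + 1 - 2 * m) = 2 * t := by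
  induction m with
  | zero =>
    intro t ht
    refine ⟨fun _ => 1, fun _ => Or.inl rfl, ?_⟩
    have : t = 0 := by simpa using ht
    simp [this]
  | succ m ih =>
    intro t ht
    obtain ⟨p, q, hp, hq, hpq⟩ : ∃ p q : ℤ, (p = 1 ∨ p = -1) ∧ (q = 1 ∨ q = -1) ∧
        |t - (2 * m + 1) * ((q - p) / 2)| ≤ (m : ℤ) ^ 2 := by
      push_cast at ht
      rw [abs_le] at ht
      have hm : (m : ℤ) ≤ (m : ℤ) ^ 2 := by exact_mod_cast Nat.le_self_pow two_ne_zero m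
      rcases lt_or_ge (m ^ 2 : ℤ) t with h | h
      · refine ⟨-1, 1, by simp, by simp, ?_⟩
        norm_num
        rw [abs_le]; constructor <;> linarith
      · rcases lt_or_ge t (-m ^ 2 : ℤ) with h' | h'
        · refine ⟨1, -1, by simp, by simp, ?_⟩
          norm_num
          rw [abs_le]; constructor <;> linarith
        · refine ⟨1, 1, by simp, by simp, ?_⟩
          norm_num
          rw [abs_le]; constructor <;> linarith
    obtain ⟨y, hy, hsum⟩ := ih _ hpq
    refine ⟨fun j => if j = 0 then p else if j = 2 * m + 1 then q else y (j - 1), ?_, ?_⟩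
    · intro j; dsimp only; split_ifs <;> simp [*]
    · rw [show 2 * (m + 1) = 2 * m + 1 + 1 by ring, Finset.sum_range_succ,
        Finset.sum_range_succ']
      have : ∑ j ∈ Finset.range (2 * m), (if j + 1 = 0 then p else if j + 1 = 2 * m + 1 then q
          else y (j + 1 - 1)) * (2 * ((j + 1 : ℕ) : ℤ) + 1 - 2 * ((m + 1 : ℕ) : ℤ)) =
          ∑ j ∈ Finset.range (2 * m), y j * (2 * j + 1 - 2 * m) := by
        refine Finset.sum_congr rfl fun j hj => ?_
        have := Finset.mem_range.mp hj
        rw [if_neg (by omega), if_neg (by omega)]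
        push_cast
        ring
      rw [this, hsum]
      rcases hp with rfl | rfl <;> rcases hq with rfl | rfl <;> norm_num <;> ring

/-- Two vertices added to the transitive tournament: the first is joined alternatingly, the second
according to `y`. -/
def borderMatrix (n : ℕ) (y : ℕ → ℤ) : Matrix (Fin n) (Fin 2) ℤ :=
  of fun i => ![(-1) ^ (i : ℕ), (-1) ^ (i : ℕ) * y i]

lemma det_schur (n : ℕ) (y : ℕ → ℤ) :
    (!![0, 1; -1, 0] - -(borderMatrix n y)ᵀ * transInv n * borderMatrix n y).det =
      (1 + ∑ j ∈ Finset.range n, y j * (2 * j + 1 - n)) ^ 2 := by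
  set W := !![0, 1; -1, 0] - -(borderMatrix n y)ᵀ * transInv n * borderMatrix n y with hW
  have hWt : Wᵀ = -W := by
    rw [hW]
    simp only [transpose_mul, transpose_transpose,
      transpose_transInv, Matrix.neg_mul, Matrix.mul_neg, sub_neg_eq_add, neg_add,
      Matrix.mul_assoc, transpose_add]
    congr 1
    ext i j; fin_cases i <;> fin_cases j <;> rfl
  have hs (i j : Fin 2) : W i j = -W j i := congr_fun₂ hWt j i
  have h01 : W 0 1 = 1 + ∑ j ∈ Finset.range n, y j * (2 * j + 1 - n) := by
    have : (-(borderMatrix n y)ᵀ * transInv n * borderMatrix n y) 0 1 =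
        ∑ j ∈ Finset.range n, -(y j * (2 * j + 1 - n)) := by
      rw [← Fin.sum_univ_eq_sum_range (fun j => -(y j * (2 * (j : ℤ) + 1 - n))), mul_apply]
      refine Finset.sum_congr rfl fun j _ => ?_
      have hj : ∑ i : Fin n, natSign i j = 2 * (j : ℕ) + 1 - n := by
        rw [Fin.sum_univ_eq_sum_range (fun i => natSign i j), natSign_sum, if_neg (by omega)]
      rw [mul_apply, ← hj, Finset.mul_sum, Finset.sum_mul, ← Finset.sum_neg_distrib]
      refine Finset.sum_congr rfl fun i _ => ?_
      simp only [borderMatrix, transInv, neg_apply, transpose_apply, of_apply, cons_val_zero,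
        cons_val_one]
      rw [natSign_swap j i]
      linear_combination (-(natSign i j * y j)) * (neg_one_pow_mul_self i * ((-1) ^ (j : ℕ) *
        (-1) ^ (j : ℕ)) + neg_one_pow_mul_self j)
    rw [hW, Matrix.sub_apply, this, Finset.sum_neg_distrib]
    simp
  rw [det_fin_two, ← h01]
  have h0 := hs 0 0
  rw [show W 0 0 = 0 by omega, hs 1 0]
  ring

lemma isSeidel_fromBlocks_submatrix {n : ℕ} {T : Matrix (Fin n) (Fin n) ℤ}
    {D : Matrix (Fin 2) (Fin 2) ℤ} {B : Matrix (Fin n) (Fin 2) ℤ} (hT : IsSeidel T)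
    (hD : IsSeidel D) (hB : ∀ i j, B i j = 1 ∨ B i j = -1) :
    IsSeidel ((fromBlocks T B (-Bᵀ) D).submatrix finSumFinEquiv.symm finSumFinEquiv.symm) := by
  refine ⟨fun i => ?_, fun i j hij => ?_, ?_⟩
  · rw [submatrix_apply]
    rcases finSumFinEquiv.symm i with a | a
    · exact hT.1 a
    · exact hD.1 a
  · have hne := finSumFinEquiv.symm.injective.ne hij
    rw [submatrix_apply]
    generalize finSumFinEquiv.symm i = a, finSumFinEquiv.symm j = b at hne ⊢
    rcases a with a | a <;> rcases b with b | b
    · exact hT.2.1 a b (by simpa using hne)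
    · exact hB a b
    · have := hB b a
      change -B b a = 1 ∨ -B b a = -1
      omega
    · exact hD.2.1 a b (by simpa using hne)
  · rw [transpose_submatrix, fromBlocks_transpose, hT.2.2, hD.2.2, transpose_neg,
      transpose_transpose]
    have h := fromBlocks_neg T B (-Bᵀ) D
    rw [neg_neg] at h
    rw [← h]
    rfl

lemma isSeidel_transMatrix (n : ℕ) : IsSeidel (transMatrix n) := by
  refine ⟨fun i => by simp [transMatrix, natSign], fun i j hij => ?_, ?_⟩
  · have : (i : ℕ) ≠ j := Fin.val_ne_of_ne hij
    simp only [transMatrix, natSign, of_apply]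
    split_ifs <;> omega
  · ext i j; exact natSign_swap _ _

/-- for even positive `n` and odd positive `k ≤ n²/2 + 1`, there is a
Seidel matrix of order `n + 2` with determinant `k²`. -/
theorem small_values_of_seidel_det (n k : ℕ) (hn : 0 < n) (hne : Even n)
    (hk : 0 < k) (hko : Odd k) (hkb : 2 * k ≤ n ^ 2 + 2) :
    ∃ S : Matrix (Fin (n + 2)) (Fin (n + 2)) ℤ, IsSeidel S ∧ S.det = (k : ℤ) ^ 2 := by
  obtain ⟨m, rfl⟩ := hne.two_dvd
  obtain ⟨t, rfl⟩ := hko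
  have ht : |(t : ℤ)| ≤ (m : ℤ) ^ 2 := by
    rw [Nat.abs_cast]
    have : t ≤ m ^ 2 := by rw [mul_pow] at hkb; omega
    exact_mod_cast this
  obtain ⟨y, hy, hsum⟩ := exists_signs_sum_eq m t ht
  refine ⟨_, isSeidel_fromBlocks_submatrix (isSeidel_transMatrix (2 * m)) isSeidel_two
    (B := borderMatrix (2 * m) y) fun i j => ?_, ?_⟩
  · have h1 := neg_one_pow_eq_or ℤ (i : ℕ)
    have h2 := hy i
    fin_cases j
    · exact h1
    · change (-1) ^ (i : ℕ) * y i = 1 ∨ (-1) ^ (i : ℕ) * y i = -1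
      rcases h1 with h1 | h1 <;> rcases h2 with h2 | h2 <;> simp [h1, h2]
  · have hinv := transMatrix_mul_transInv hne
    let _ : Invertible (transMatrix (2 * m)) := invertibleOfRightInverse _ _ hinv
    rw [det_submatrix_equiv_self, det_fromBlocks₁₁, det_transMatrix hne, one_mul,
      invOf_eq_right_inv hinv, det_schur]
    push_cast
    rw [hsum]
    ring
end

section
/- There exists a natural number N such that for every even integer n ≥ N there is a Seidel matrix S of order n with (det S : ℝ) ≥ (n − n^(0.6))^((n − n^(0.6) + 1)/2), where powers are real powers. -/
open Matrix Real

theorem dotProduct_mulVec_self_of_skew {ι : Type*} [Fintype ι]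
    {M : Matrix ι ι ℝ} (hM : Mᵀ = -M) (v : ι → ℝ) : v ⬝ᵥ (M *ᵥ v) = 0 := by
  have h : v ⬝ᵥ (M *ᵥ v) = -(v ⬝ᵥ (M *ᵥ v)) := by
    conv_lhs => rw [dotProduct_mulVec, ← mulVec_transpose, hM, neg_mulVec, neg_dotProduct,
      dotProduct_comm]
  linarith

theorem det_one_add_ne_zero_of_skew {ι : Type*} [Fintype ι] [DecidableEq ι]
    {M : Matrix ι ι ℝ} (hM : Mᵀ = -M) : (1 + M).det ≠ 0 := by
  intro h
  obtain ⟨v, hv, hv0⟩ := exists_mulVec_eq_zero_iff.mpr h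
  apply hv
  have h1 : v ⬝ᵥ ((1 + M) *ᵥ v) = 0 := by rw [hv0, dotProduct_zero]
  rw [add_mulVec, one_mulVec, dotProduct_add, dotProduct_mulVec_self_of_skew hM, add_zero] at h1
  exact dotProduct_self_eq_zero.mp h1

theorem det_one_add_pos_of_skew {ι : Type*} [Fintype ι] [DecidableEq ι]
    {M : Matrix ι ι ℝ} (hM : Mᵀ = -M) : 0 < (1 + M).det := by
  by_contra! hle
  have hc : Continuous fun s : ℝ => (1 + s • M).det := by fun_prop
  have hmem : (0 : ℝ) ∈ Set.Icc ((1 + (1 : ℝ) • M).det) ((1 + (0 : ℝ) • M).det) := by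
    constructor <;> simp [hle]
  obtain ⟨s, -, hs⟩ := intermediate_value_Icc' zero_le_one hc.continuousOn hmem
  exact det_one_add_ne_zero_of_skew (M := s • M) (by simp [hM]) hs

/-- The determinant of a real skew-symmetric matrix is nonnegative. -/
theorem det_nonneg_of_skew {ι : Type*} [Fintype ι] [DecidableEq ι]
    {M : Matrix ι ι ℝ} (hM : Mᵀ = -M) : 0 ≤ M.det := by
  have hc : Continuous fun s : ℝ => (s • (1 : Matrix ι ι ℝ) + M).det := by fun_prop
  have hpos : ∀ s : ℝ, 0 < s → 0 ≤ (s • (1 : Matrix ι ι ℝ) + M).det := by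
    intro s hs
    have : s • (1 : Matrix ι ι ℝ) + M = s • (1 + s⁻¹ • M) := by
      rw [smul_add, smul_smul, mul_inv_cancel₀ hs.ne', one_smul]
    rw [this, det_smul]
    have := det_one_add_pos_of_skew (M := s⁻¹ • M) (by simp [hM])
    positivity
  have hlim := (hc.tendsto 0).mono_left (nhdsWithin_le_nhds (s := Set.Ioi 0))
  have := ge_of_tendsto hlim (Filter.eventually_of_mem self_mem_nhdsWithin hpos)
  simpa using this

theorem int_det_nonneg_of_skew {ι : Type*} [Fintype ι] [DecidableEq ι]
    {M : Matrix ι ι ℤ} (hM : Mᵀ = -M) : 0 ≤ M.det := by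
  have h := det_nonneg_of_skew (M := M.map (Int.castRingHom ℝ)) (by
    rw [← transpose_map, hM]; ext; simp)
  rw [← RingHom.mapMatrix_apply, ← RingHom.map_det] at h
  simpa using h

/-- Adding `x` at `(i, j)` and `-x` at `(j, i)` changes the determinant by a quadratic in `x`. -/
theorem exists_det_quadratic {ι : Type*} [Fintype ι] [DecidableEq ι]
    (M : Matrix ι ι ℤ) {i j : ι} (hij : i ≠ j) :
    ∃ b c : ℤ, ∀ x : ℤ,
      (M + x • (single i j 1 - single j i 1)).det = M.det + b * x + c * x ^ 2 := by
  let e : ι → ι → ℤ := fun k => Pi.single k 1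
  refine ⟨(M.updateRow i (e j)).det - (M.updateRow j (e i)).det,
    -((M.updateRow i (e j)).updateRow j (e i)).det, fun x => ?_⟩
  have h : M + x • (single i j 1 - single j i 1) =
      (M.updateRow i (M i + x • e j)).updateRow j (M j + (-x) • e i) := by
    ext a b
    simp only [Matrix.add_apply, Matrix.smul_apply, Matrix.sub_apply, single_apply, smul_eq_mul,
      updateRow_apply, Pi.add_apply, Pi.smul_apply, e, Pi.single_apply]
    by_cases haj : a = j
    · subst haj
      simp only [hij, eq_comm, false_and, if_false, true_and, zero_sub, mul_neg, mul_ite, mul_one,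
        mul_zero, if_true]
      split_ifs <;> simp
    · by_cases hai : a = i
      · subst hai
        simp [hij, hij.symm, eq_comm]
      · simp [haj, hai, Ne.symm haj, Ne.symm hai]
  have h1 : (M.updateRow i (M i)).updateRow j (M j) = M := by simp
  have h2 : (M.updateRow i (e j)).updateRow j (M j) = M.updateRow i (e j) := by
    ext a b
    by_cases haj : a = j
    · subst haj; simp [hij.symm]
    · simp [haj]
  rw [h, det_updateRow_add, det_updateRow_smul, updateRow_comm _ hij, updateRow_comm _ hij,
    det_updateRow_add, det_updateRow_smul, det_updateRow_add, det_updateRow_smul,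
    updateRow_comm _ hij.symm, updateRow_comm _ hij.symm, updateRow_comm _ hij.symm,
    updateRow_comm _ hij.symm, h1, h2]
  simp only [updateRow_eq_self]
  ring

theorem exists_sign_det_ge {ι : Type*} [Fintype ι] [DecidableEq ι]
    {M : Matrix ι ι ℤ} (hM : Mᵀ = -M) {i j : ι} (hij : i ≠ j) :
    ∃ x : ℤ, (x = 1 ∨ x = -1) ∧ M.det ≤ (M + x • (single i j 1 - single j i 1)).det := by
  obtain ⟨b, c, h⟩ := exists_det_quadratic M hij
  have hnn : ∀ x : ℤ, 0 ≤ M.det + b * x + c * x ^ 2 := by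
    intro x
    rw [← h]
    apply int_det_nonneg_of_skew
    simp only [transpose_add, transpose_smul, transpose_sub, transpose_single, hM, neg_add,
      ← smul_neg, neg_sub]
  have hc : 0 ≤ c := by
    by_contra! hc
    have h0 := int_det_nonneg_of_skew hM
    have h1 := hnn (M.det + 1)
    have h2 := hnn (-(M.det + 1))
    nlinarith [sq_nonneg (M.det + 1)]
  rcases le_total 0 b with hb | hb
  · exact ⟨1, Or.inl rfl, by rw [h]; linarith⟩
  · exact ⟨-1, Or.inr rfl, by rw [h]; linarith⟩

/-- The zero off-diagonal entries of a skew-symmetric `{0, ±1}`-matrix can be replaced by signs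
without decreasing the determinant. -/
theorem exists_seidel_det_ge {n : ℕ} (M : Matrix (Fin n) (Fin n) ℤ) (hM : Mᵀ = -M)
    (h01 : ∀ i j, M i j = 0 ∨ M i j = 1 ∨ M i j = -1) :
    ∃ S : Matrix (Fin n) (Fin n) ℤ, IsSeidel S ∧ M.det ≤ S.det := by
  induction hk : (Finset.univ.filter fun p : Fin n × Fin n => p.1 ≠ p.2 ∧ M p.1 p.2 = 0).card
    using Nat.strong_induction_on generalizing M with
  | _ k ih =>
  have hsk : ∀ a b, M b a = -M a b := fun a b => congrFun (congrFun hM a) b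
  by_cases hall : ∃ i j, i ≠ j ∧ M i j = 0
  · obtain ⟨i, j, hij, h0⟩ := hall
    have h0' : M j i = 0 := by rw [hsk i j, h0, neg_zero]
    obtain ⟨x, hx, hle⟩ := exists_sign_det_ge hM hij
    set M' := M + x • (single i j 1 - single j i 1) with hM'
    have hM'T : M'ᵀ = -M' := by
      simp only [hM', transpose_add, transpose_smul, transpose_sub, transpose_single, hM, neg_add,
        ← smul_neg, neg_sub]
    have hent : ∀ a b, M' a b = if a = i ∧ b = j then x else if a = j ∧ b = i then -x
        else M a b := by
      intro a b
      simp only [hM', Matrix.add_apply, Matrix.smul_apply, Matrix.sub_apply, single_apply,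
        smul_eq_mul]
      by_cases h1 : a = i ∧ b = j
      · obtain ⟨rfl, rfl⟩ := h1
        simp [h0, hij, hij.symm]
      · by_cases h2 : a = j ∧ b = i
        · obtain ⟨rfl, rfl⟩ := h2
          simp [h0', hij, hij.symm]
        · rw [if_neg h1, if_neg h2, if_neg (fun h => h1 ⟨h.1.symm, h.2.symm⟩),
            if_neg (fun h => h2 ⟨h.1.symm, h.2.symm⟩)]
          simp
    have hx0 : x ≠ 0 := by rcases hx with rfl | rfl <;> norm_num
    obtain ⟨S, hS, hdet⟩ := ih _ (by
      rw [← hk]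
      apply Finset.card_lt_card
      refine Finset.ssubset_iff_of_subset ?_ |>.mpr ⟨(i, j), ?_, ?_⟩
      · intro p hp
        simp only [Finset.mem_filter, Finset.mem_univ, true_and] at hp ⊢
        refine ⟨hp.1, ?_⟩
        have := hp.2
        rw [hent] at this
        split_ifs at this
        · exact absurd this hx0
        · exact absurd (neg_eq_zero.mp this) hx0
        · exact this
      · simp [hij, h0]
      · simp [hent, hx0]) M' hM'T (by
        intro a b
        rw [hent]
        split_ifs
        · exact Or.inr hx
        · rcases hx with rfl | rfl <;> simp
        · exact h01 a b) rfl
    exact ⟨S, hS, hle.trans hdet⟩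
  · push Not at hall
    refine ⟨M, ⟨fun i => ?_, fun i j hij => ?_, hM⟩, le_rfl⟩
    · have := hsk i i
      omega
    · exact (h01 i j).resolve_left (hall i j hij)

/-- The quadratic Gauss-type sum `∑ u ⊆ s, (-1) ^ (|u| choose 2) * ∏ i ∈ u, ε i`. -/
def gaussA {ι : Type*} (ε : ι → ℤ) (s : Finset ι) : ℤ :=
  ∑ u ∈ s.powerset, (-1) ^ (u.card.choose 2) * ∏ i ∈ u, ε i

/-- The shifted Gauss-type sum `∑ u ⊆ s, (-1) ^ ((|u| + 1) choose 2) * ∏ i ∈ u, ε i`. -/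
def gaussB {ι : Type*} (ε : ι → ℤ) (s : Finset ι) : ℤ :=
  ∑ u ∈ s.powerset, (-1) ^ ((u.card + 1).choose 2) * ∏ i ∈ u, ε i

theorem gaussA_insert {ι : Type*} [DecidableEq ι] (ε : ι → ℤ) {s : Finset ι} {a : ι}
    (ha : a ∉ s) : gaussA ε (insert a s) = gaussA ε s + ε a * gaussB ε s := by
  unfold gaussA gaussB
  rw [Finset.sum_powerset_insert ha, Finset.mul_sum]
  congr 1
  refine Finset.sum_congr rfl fun u hu => ?_
  have hau : a ∉ u := fun h => ha (Finset.mem_powerset.mp hu h)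
  rw [Finset.card_insert_of_notMem hau, Finset.prod_insert hau]
  ring

theorem gaussB_insert {ι : Type*} [DecidableEq ι] (ε : ι → ℤ) {s : Finset ι} {a : ι}
    (ha : a ∉ s) : gaussB ε (insert a s) = gaussB ε s - ε a * gaussA ε s := by
  unfold gaussA gaussB
  rw [Finset.sum_powerset_insert ha, Finset.mul_sum, sub_eq_add_neg, ← Finset.sum_neg_distrib]
  congr 1
  refine Finset.sum_congr rfl fun u hu => ?_
  have hau : a ∉ u := fun h => ha (Finset.mem_powerset.mp hu h)
  have hc : (u.card + 1 + 1).choose 2 = u.card.choose 2 + 2 * u.card + 1 := by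
    rw [Nat.choose_succ_succ' (u.card + 1) 1, Nat.choose_succ_succ' u.card 1]
    simp
    ring
  rw [Finset.card_insert_of_notMem hau, Finset.prod_insert hau, hc, pow_add, pow_add, pow_mul]
  simp
  ring

theorem gauss_sq {ι : Type*} [DecidableEq ι] {ε : ι → ℤ} (hε : ∀ i, ε i * ε i = 1)
    (s : Finset ι) :
    gaussA ε s ^ 2 + gaussB ε s ^ 2 = 2 ^ (s.card + 1) ∧
      (Even s.card → gaussA ε s ^ 2 = gaussB ε s ^ 2) ∧
      (Odd s.card → gaussA ε s * gaussB ε s = 0) := by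
  induction s using Finset.induction_on with
  | empty => simp [gaussA, gaussB]
  | insert a s ha ih =>
    obtain ⟨h1, h2, h3⟩ := ih
    rw [gaussA_insert ε ha, gaussB_insert ε ha, Finset.card_insert_of_notMem ha]
    refine ⟨?_, fun he => ?_, fun ho => ?_⟩
    · rw [pow_succ (2 : ℤ), ← h1]
      linear_combination (gaussA ε s ^ 2 + gaussB ε s ^ 2) * hε a
    · have h := h3 (by rw [Nat.even_add_one, Nat.not_even_iff_odd] at he; exact he)
      linear_combination 4 * ε a * h + (gaussB ε s ^ 2 - gaussA ε s ^ 2) * hε a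
    · have h := h2 (by rw [Nat.odd_add_one, Nat.not_odd_iff_even] at ho; exact ho)
      linear_combination -ε a * h - gaussA ε s * gaussB ε s * hε a

theorem gaussA_eq {ι : Type*} [DecidableEq ι] {ε : ι → ℤ} (hε : ∀ i, ε i * ε i = 1)
    {s : Finset ι} {h : ℕ} (hs : s.card = 2 * h) :
    gaussA ε s = 2 ^ h * 1 ∨ gaussA ε s = 2 ^ h * -1 := by
  obtain ⟨h1, h2, -⟩ := gauss_sq hε s
  have h2 := h2 (by rw [hs]; exact even_two_mul h)
  rw [hs, ← h2] at h1
  have : gaussA ε s ^ 2 = (2 ^ h) ^ 2 := by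
    rw [← pow_mul, mul_comm h 2]
    rw [pow_succ (2 : ℤ)] at h1
    linarith
  rw [mul_neg, mul_one]
  exact sq_eq_sq_iff_eq_or_eq_neg.mp this

/-- The Jordan-Wigner sign. -/
def jwSign {m : ℕ} (k : Fin m) (u : Finset (Fin m)) : ℤ :=
  ∏ i ∈ u, if i < k then -1 else 1

/-- The fermionic ladder operator indexed by `k`, acting on subsets. -/
def ladder {m : ℕ} (k : Fin m) : Matrix (Finset (Fin m)) (Finset (Fin m)) ℤ :=
  fun u w => if k ∉ u ∧ w = insert k u then jwSign k u else 0

theorem jwSign_insert {m : ℕ} (k : Fin m) {l : Fin m} {u : Finset (Fin m)} (hl : l ∉ u) :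
    jwSign k (insert l u) = (if l < k then -1 else 1) * jwSign k u := by
  rw [jwSign, Finset.prod_insert hl, jwSign]

theorem jwSign_mul_self {m : ℕ} (k : Fin m) (u : Finset (Fin m)) :
    jwSign k u * jwSign k u = 1 := by
  rw [jwSign, ← Finset.prod_mul_distrib]
  exact Finset.prod_eq_one fun i _ => by split_ifs <;> norm_num

theorem ladder_mul_apply {m : ℕ} (k : Fin m) (B : Matrix (Finset (Fin m)) (Finset (Fin m)) ℤ)
    (u w : Finset (Fin m)) :
    (ladder k * B) u w = if k ∈ u then 0 else jwSign k u * B (insert k u) w := by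
  rw [Matrix.mul_apply]
  by_cases hk : k ∈ u <;> simp [ladder, hk]

theorem ladder_transpose_mul_apply {m : ℕ} (k : Fin m)
    (B : Matrix (Finset (Fin m)) (Finset (Fin m)) ℤ) (u w : Finset (Fin m)) :
    ((ladder k)ᵀ * B) u w =
      if k ∈ u then jwSign k (u.erase k) * B (u.erase k) w else 0 := by
  rw [Matrix.mul_apply]
  by_cases hk : k ∈ u
  · rw [if_pos hk, Finset.sum_eq_single (u.erase k)]
    · simp [ladder, hk]
    · intro v _ hv
      rw [transpose_apply, ladder, if_neg, zero_mul]
      rintro ⟨h1, rfl⟩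
      exact hv (Finset.erase_insert h1).symm
    · simp
  · rw [if_neg hk]
    refine Finset.sum_eq_zero fun v _ => ?_
    rw [transpose_apply, ladder, if_neg, zero_mul]
    rintro ⟨h1, rfl⟩
    simp at hk

theorem lt_sign_mul {m : ℕ} {k l : Fin m} (h : k ≠ l) :
    (if l < k then (-1 : ℤ) else 1) * (if k < l then -1 else 1) = -1 := by
  rcases lt_or_gt_of_ne h with h | h <;> simp [h, h.le, not_lt_of_ge]

theorem ladder_anticomm {m : ℕ} (k l : Fin m) :
    ladder k * ladder l + ladder l * ladder k = 0 := by
  ext u w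
  rw [Matrix.add_apply, ladder_mul_apply, ladder_mul_apply, Matrix.zero_apply]
  by_cases hkl : k = l
  · subst hkl
    simp [ladder]
  · by_cases hk : k ∈ u
    · simp [ladder, hk]
    · by_cases hl : l ∈ u
      · simp [ladder, hl]
      · simp only [ladder, hk, hl, if_false, Finset.mem_insert, hkl, Ne.symm hkl, or_self,
          not_false_eq_true, true_and, Finset.insert_comm k l]
        split_ifs with hw
        · rw [jwSign_insert k hl, jwSign_insert l hk]
          have := lt_sign_mul hkl
          rcases lt_or_gt_of_ne hkl with h | h <;> simp [h, not_lt_of_ge h.le] <;> ring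
        · simp

theorem ladder_car {m : ℕ} (k l : Fin m) :
    ladder k * (ladder l)ᵀ + (ladder l)ᵀ * ladder k = if k = l then 1 else 0 := by
  ext u w
  rw [Matrix.add_apply, ladder_mul_apply, ladder_transpose_mul_apply, transpose_apply]
  by_cases hkl : k = l
  · subst hkl
    rw [if_pos rfl, one_apply]
    by_cases hk : k ∈ u
    · simp only [hk, if_true, ladder, Finset.notMem_erase, not_false_eq_true, true_and,
        Finset.insert_erase hk, zero_add]
      rcases eq_or_ne u w with rfl | h
      · simp [jwSign_mul_self]
      · simp [h, h.symm]
    · simp only [hk, if_false, ladder, add_zero]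
      rcases eq_or_ne u w with rfl | h
      · simp [hk, jwSign_mul_self]
      · rw [if_neg h, if_neg, mul_zero]
        rintro ⟨h1, h2⟩
        apply h
        rw [← Finset.erase_insert hk, h2, Finset.erase_insert h1]
  · rw [if_neg hkl, Matrix.zero_apply]
    by_cases hk : k ∈ u
    · simp [ladder, hk, hkl]
    · by_cases hl : l ∈ u
      · obtain ⟨t, ht, rfl⟩ : ∃ t, l ∉ t ∧ insert l t = u :=
          ⟨u.erase l, Finset.notMem_erase l u, Finset.insert_erase hl⟩
        have hkt : k ∉ t := fun h => hk (Finset.mem_insert_of_mem h)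
        simp only [hk, hl, if_true, if_false, Finset.erase_insert ht, ladder, hkt,
          not_false_eq_true, true_and]
        by_cases hw : w = insert k t
        · subst hw
          have : l ∉ insert k t := by simp [ht, Ne.symm hkl]
          rw [if_pos ⟨this, Finset.insert_comm k l t⟩, if_pos rfl, jwSign_insert k ht,
            jwSign_insert l hkt]
          linear_combination (jwSign k t * jwSign l t) * lt_sign_mul hkl
        · rw [if_neg hw, if_neg]
          · simp
          · rintro ⟨h1, h2⟩
            rw [Finset.insert_comm] at h2
            have hlk : l ∉ insert k t := by simp [ht, Ne.symm hkl]
            apply hw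
            rw [← Finset.erase_insert h1, ← h2, Finset.erase_insert hlk]
      · simp only [hk, hl, if_false, ladder, add_zero]
        rw [if_neg, mul_zero]
        rintro ⟨h1, h2⟩
        have : l ∈ insert k u := h2 ▸ Finset.mem_insert_self l w
        simp [hl, Ne.symm hkl] at this

/-- The character `∏ i ∈ u, (-1) ^ [i ∈ x]` on subsets. -/
def subsetChar {ι : Type*} [DecidableEq ι] (u x : Finset ι) : ℤ :=
  ∏ i ∈ u, if i ∈ x then -1 else 1

theorem subsetChar_comm {ι : Type*} [DecidableEq ι] (u x : Finset ι) :
    subsetChar u x = subsetChar x u := by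
  unfold subsetChar
  rw [Finset.prod_ite_mem, Finset.prod_ite_mem, Finset.inter_comm]

theorem sum_subsetChar_mul {ι : Type*} [DecidableEq ι] [Fintype ι] (x y : Finset ι) :
    ∑ u, subsetChar u x * subsetChar u y = if x = y then 2 ^ Fintype.card ι else 0 := by
  unfold subsetChar
  simp_rw [← Finset.prod_mul_distrib]
  rw [← Finset.powerset_univ, ← Finset.prod_one_add]
  split_ifs with h
  · subst h
    rw [Finset.prod_congr rfl (g := fun _ => (2 : ℤ))]
    · simp
    · intro i _
      split_ifs <;> norm_num
  · obtain ⟨i, hi⟩ : ∃ i, ¬(i ∈ x ↔ i ∈ y) := by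
      by_contra! h'
      exact h (Finset.ext h')
    apply Finset.prod_eq_zero (Finset.mem_univ i)
    by_cases hx : i ∈ x <;> by_cases hy : i ∈ y <;> simp_all

/-- A Hadamard matrix indexed by subsets. -/
def cubicHadamard (m : ℕ) : Matrix (Finset (Fin m)) (Finset (Fin m)) ℤ :=
  fun u x => (-1) ^ (u.card.choose 3) * subsetChar u x

theorem cubicHadamard_transpose_mul_self (m : ℕ) :
    (cubicHadamard m)ᵀ * cubicHadamard m = (2 ^ m : ℤ) • 1 := by
  ext x y
  rw [Matrix.mul_apply]
  have : ∀ u, (cubicHadamard m)ᵀ x u * cubicHadamard m u y = subsetChar u x * subsetChar u y := by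
    intro u
    simp only [transpose_apply, cubicHadamard]
    have : ((-1 : ℤ) ^ (u.card.choose 3)) * (-1) ^ (u.card.choose 3) = 1 := by
      rw [← mul_pow]; simp
    linear_combination (subsetChar u x * subsetChar u y) * this
  simp_rw [this, sum_subsetChar_mul]
  simp [one_apply]

theorem cubicHadamard_mul_transpose_self (m : ℕ) :
    cubicHadamard m * (cubicHadamard m)ᵀ = (2 ^ m : ℤ) • 1 := by
  ext u v
  rw [Matrix.mul_apply]
  have : ∀ x, cubicHadamard m u x * (cubicHadamard m)ᵀ x v =
      (-1) ^ (u.card.choose 3) * (-1) ^ (v.card.choose 3) * (subsetChar x u * subsetChar x v) := by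
    intro x
    simp only [transpose_apply, cubicHadamard, subsetChar_comm u x, subsetChar_comm v x]
    ring
  simp_rw [this, ← Finset.mul_sum, sum_subsetChar_mul]
  rcases eq_or_ne u v with rfl | h
  · simp [← mul_pow]
  · simp [h]

theorem conj_ladder_apply {m : ℕ} (k : Fin m) (x y : Finset (Fin m)) :
    ((cubicHadamard m)ᵀ * ladder k * cubicHadamard m) x y =
      (if k ∈ y then -1 else 1) * gaussA (fun i => (if i < k then -1 else 1) *
        (if i ∈ x then -1 else 1) * (if i ∈ y then -1 else 1)) (Finset.univ.erase k) := by
  rw [Matrix.mul_assoc, Matrix.mul_apply, gaussA, Finset.mul_sum]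
  symm
  apply Finset.sum_subset_zero_on_sdiff (Finset.subset_univ _)
  · intro u hu
    have hk : k ∈ u := by
      by_contra hk
      apply (Finset.mem_sdiff.mp hu).2
      rw [Finset.mem_powerset]
      exact fun i hi => Finset.mem_erase.mpr ⟨fun h => hk (h ▸ hi), Finset.mem_univ _⟩
    rw [ladder_mul_apply, if_pos hk, mul_zero]
  · intro u hu
    have hk : k ∉ u := fun h => Finset.notMem_erase k _ (Finset.mem_powerset.mp hu h)
    rw [ladder_mul_apply, if_neg hk, transpose_apply, cubicHadamard, cubicHadamard,
      Finset.card_insert_of_notMem hk, Nat.choose_succ_succ' u.card 2, pow_add,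
      Finset.prod_mul_distrib, Finset.prod_mul_distrib, subsetChar, subsetChar,
      Finset.prod_insert hk, ← jwSign]
    have : ((-1 : ℤ) ^ (u.card.choose 3)) * (-1) ^ (u.card.choose 3) = 1 := by
      rw [← mul_pow]; simp
    linear_combination (-(if k ∈ y then -1 else 1) * (-1) ^ (u.card.choose 2) * jwSign k u *
      (∏ i ∈ u, if i ∈ x then -1 else 1) * (∏ i ∈ u, if i ∈ y then -1 else 1)) * this

/-- Canonical anticommutation relations can be realised, up to scaling, by sign matrices. -/
theorem exists_sign_car (h : ℕ) :
    ∃ α : Fin (2 * h + 1) → Matrix (Finset (Fin (2 * h + 1))) (Finset (Fin (2 * h + 1))) ℤ,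
      (∀ k x y, α k x y = 1 ∨ α k x y = -1) ∧
      (∀ k l, α k * α l + α l * α k = 0) ∧
      (∀ k l, α k * (α l)ᵀ + (α l)ᵀ * α k = if k = l then (2 ^ (2 * h + 2) : ℤ) • 1 else 0) := by
  set O := cubicHadamard (2 * h + 1) with hO
  have hex : ∀ k x y, ∃ a : ℤ, (a = 1 ∨ a = -1) ∧
      (Oᵀ * ladder k * O : Matrix _ _ ℤ) x y = 2 ^ h * a := by
    intro k x y
    rw [hO, conj_ladder_apply]
    rcases gaussA_eq (ε := fun i => (if i < k then -1 else 1) *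
        (if i ∈ x then -1 else 1) * (if i ∈ y then -1 else 1)) (fun i => by
          split_ifs <;> norm_num) (s := Finset.univ.erase k) (h := h) (by simp) with
      h1 | h1
    all_goals
      rw [h1]
      split_ifs
    · exact ⟨-1, by simp⟩
    · exact ⟨1, by simp⟩
    · exact ⟨1, by simp⟩
    · exact ⟨-1, by simp⟩
  obtain ⟨α, hα, hmul⟩ : ∃ α : Fin (2 * h + 1) → Matrix (Finset (Fin (2 * h + 1)))
      (Finset (Fin (2 * h + 1))) ℤ, (∀ k x y, α k x y = 1 ∨ α k x y = -1) ∧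
      ∀ k x y, (Oᵀ * ladder k * O : Matrix _ _ ℤ) x y = 2 ^ h * α k x y := by
    choose α hα hmul using hex
    exact ⟨fun k => Matrix.of (α k), hα, hmul⟩
  have hsm : ∀ k, Oᵀ * ladder k * O = (2 ^ h : ℤ) • α k := by
    intro k
    ext x y
    rw [hmul]
    rfl
  have hsmT : ∀ k, Oᵀ * (ladder k)ᵀ * O = (2 ^ h : ℤ) • (α k)ᵀ := by
    intro k
    rw [← transpose_smul, ← hsm, transpose_mul, transpose_mul, transpose_transpose,
      Matrix.mul_assoc]
  have hprod : ∀ A B : Matrix (Finset (Fin (2 * h + 1))) (Finset (Fin (2 * h + 1))) ℤ,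
      (Oᵀ * A * O) * (Oᵀ * B * O) = (2 ^ (2 * h + 1) : ℤ) • (Oᵀ * (A * B) * O) := by
    intro A B
    calc (Oᵀ * A * O) * (Oᵀ * B * O) = Oᵀ * A * (O * Oᵀ) * B * O := by
          simp only [Matrix.mul_assoc]
      _ = _ := by
          rw [hO, cubicHadamard_mul_transpose_self]
          simp only [Matrix.mul_smul, Matrix.smul_mul, Matrix.mul_one, Matrix.mul_assoc]
  have h4 : (2 ^ h * 2 ^ h : ℤ) ≠ 0 := by positivity
  refine ⟨α, hα, fun k l => ?_, fun k l => ?_⟩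
  · apply smul_right_injective _ h4
    have := congrArg₂ (· + ·) (hprod (ladder k) (ladder l)) (hprod (ladder l) (ladder k))
    beta_reduce at this
    rw [← smul_add, ← Matrix.add_mul, ← Matrix.mul_add, ladder_anticomm, Matrix.mul_zero,
      Matrix.zero_mul, hsm, hsm, Matrix.smul_mul, Matrix.mul_smul, Matrix.smul_mul,
      Matrix.mul_smul, smul_smul, smul_smul, ← smul_add, smul_zero] at this
    beta_reduce
    rw [this, smul_zero]
  · apply smul_right_injective _ h4
    have := congrArg₂ (· + ·) (hprod (ladder k) (ladder l)ᵀ) (hprod (ladder l)ᵀ (ladder k))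
    beta_reduce at this
    rw [← smul_add, ← Matrix.add_mul, ← Matrix.mul_add, ladder_car, hsm, hsmT, Matrix.smul_mul,
      Matrix.mul_smul, Matrix.smul_mul, Matrix.mul_smul, smul_smul, smul_smul, ← smul_add] at this
    beta_reduce
    rw [this]
    split_ifs
    · rw [Matrix.mul_one, hO, cubicHadamard_transpose_mul_self, smul_smul, smul_smul]
      congr 1
      ring
    · simp

/-- Evaluation of the polynomial with coefficient list `l` at `z`. -/
def listEval {R : Type*} [CommRing R] (z : R) : List ℤ → R
  | [] => 0
  | c :: l => c + z * listEval z l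

theorem listEval_append {R : Type*} [CommRing R] (z : R) (l l' : List ℤ) :
    listEval z (l ++ l') = listEval z l + z ^ l.length * listEval z l' := by
  induction l with
  | nil => simp [listEval]
  | cons c l ih =>
    simp only [List.cons_append, listEval, ih, List.length_cons]
    ring

theorem listEval_map_neg {R : Type*} [CommRing R] (z : R) (l : List ℤ) :
    listEval z (l.map Neg.neg) = -listEval z l := by
  induction l with
  | nil => simp [listEval]
  | cons c l ih =>
    simp only [List.map_cons, listEval, ih]
    push_cast
    ring

/-- A Golay complementary pair of sign sequences. -/
structure IsGolayPair (a b : List ℤ) : Prop where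
  length_eq : a.length = b.length
  sign_left : ∀ c ∈ a, c = 1 ∨ c = -1
  sign_right : ∀ c ∈ b, c = 1 ∨ c = -1
  complementary : ∀ (R : Type) [CommRing R] (z w : R), z * w = 1 →
    listEval z a * listEval w a + listEval z b * listEval w b = 2 * a.length

/-- The lengths of Golay complementary pairs. -/
def IsGolayLength (n : ℕ) : Prop :=
  ∃ a b : List ℤ, IsGolayPair a b ∧ a.length = n

theorem IsGolayLength.two_mul {n : ℕ} (hn : IsGolayLength n) : IsGolayLength (2 * n) := by
  obtain ⟨a, b, h, rfl⟩ := hn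
  refine ⟨a ++ b, a ++ b.map Neg.neg, ⟨?_, ?_, ?_, ?_⟩, ?_⟩
  · simp
  · intro c hc
    rcases List.mem_append.mp hc with hc | hc
    exacts [h.sign_left c hc, h.sign_right c hc]
  · intro c hc
    rcases List.mem_append.mp hc with hc | hc
    · exact h.sign_left c hc
    · obtain ⟨d, hd, rfl⟩ := List.mem_map.mp hc
      rcases h.sign_right d hd with rfl | rfl <;> simp
  · intro R _ z w hzw
    have h1 := h.complementary R z w hzw
    have h2 : z ^ a.length * w ^ a.length = 1 := by rw [← mul_pow, hzw, one_pow]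
    simp only [listEval_append, listEval_map_neg, List.length_append, ← h.length_eq]
    push_cast
    linear_combination 2 * h1 + 2 * (listEval z b * listEval w b) * h2
  · rw [List.length_append, ← h.length_eq]
    ring

theorem isGolayLength_one : IsGolayLength 1 := by
  refine ⟨[1], [1], ⟨rfl, by simp, by simp, fun R _ z w _ => ?_⟩, rfl⟩
  simp [listEval]
  norm_num

theorem isGolayLength_ten : IsGolayLength 10 := by
  refine ⟨[1, 1, -1, 1, -1, 1, -1, -1, 1, 1], [1, 1, -1, 1, 1, 1, 1, 1, -1, -1],
    ⟨rfl, by simp, by simp, fun R _ z w hzw => ?_⟩, rfl⟩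
  simp only [listEval]
  push_cast [List.length]
  grind

theorem isGolayLength_two_pow_mul {n : ℕ} (hn : IsGolayLength n) (a : ℕ) :
    IsGolayLength (2 ^ a * n) := by
  induction a with
  | zero => simpa using hn
  | succ a ih =>
    rw [pow_succ, mul_comm (2 ^ a), mul_assoc]
    exact ih.two_mul

/-- Every positive integer is a sum of logarithmically few Golay lengths. -/
theorem exists_golay_sum (q : ℕ) (hq : 0 < q) :
    ∃ L : List ℕ, (∀ l ∈ L, IsGolayLength l) ∧ L.sum = q ∧
      4 ^ (20 * L.length) ≤ 4 ^ 60 * q ^ 29 := by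
  have hpow : ∀ a, IsGolayLength (2 ^ a) := fun a => by
    simpa using isGolayLength_two_pow_mul isGolayLength_one a
  induction q using Nat.strong_induction_on with
  | _ q ih =>
  have hq29 : 1 ≤ q ^ 29 := Nat.one_le_pow _ _ hq
  rcases lt_or_ge q 8 with h8 | h8
  · have h1 := hpow 0
    have h2 := hpow 1
    have h4 := hpow 2
    norm_num at h1 h2 h4
    have hlen : ∃ L : List ℕ, (∀ l ∈ L, IsGolayLength l) ∧ L.sum = q ∧ L.length ≤ 3 := by
      interval_cases q
      · exact ⟨[1], by simp [h1], rfl, by simp⟩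
      · exact ⟨[2], by simp [h2], rfl, by simp⟩
      · exact ⟨[2, 1], by simp [h1, h2], rfl, by simp⟩
      · exact ⟨[4], by simp [h4], rfl, by simp⟩
      · exact ⟨[4, 1], by simp [h1, h4], rfl, by simp⟩
      · exact ⟨[4, 2], by simp [h2, h4], rfl, by simp⟩
      · exact ⟨[4, 2, 1], by simp [h1, h2, h4], rfl, by simp⟩
    obtain ⟨L, hL, hs, hl⟩ := hlen
    refine ⟨L, hL, hs, ?_⟩
    calc 4 ^ (20 * L.length) ≤ 4 ^ 60 := Nat.pow_le_pow_right (by norm_num) (by omega)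
      _ ≤ 4 ^ 60 * q ^ 29 := Nat.le_mul_of_pos_right _ hq29
  · obtain ⟨l, hl, hlq, hrem⟩ : ∃ l, IsGolayLength l ∧ l ≤ q ∧ 0 < l ∧ 8 * (q - l) ≤ 3 * q := by
      have h3 : 3 ≤ Nat.log 2 q := Nat.le_log_of_pow_le (by norm_num) (by omega)
      obtain ⟨b, hb⟩ := Nat.exists_eq_add_of_le h3
      have hlo : 2 ^ Nat.log 2 q ≤ q := Nat.pow_log_le_self 2 (by omega)
      have hhi : q < 2 ^ (Nat.log 2 q + 1) := Nat.lt_pow_succ_log_self (by norm_num) q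
      rw [hb] at hlo hhi
      have e1 : 2 ^ (3 + b) = 8 * 2 ^ b := by ring
      have e2 : 2 ^ (3 + b + 1) = 16 * 2 ^ b := by ring
      have hpos : 0 < 2 ^ b := by positivity
      rw [e1] at hlo
      rw [e2] at hhi
      rcases le_or_gt (2 ^ b * 10) q with h | h
      · exact ⟨2 ^ b * 10, isGolayLength_two_pow_mul isGolayLength_ten b, h, by omega, by omega⟩
      · exact ⟨2 ^ (3 + b), hpow _, by omega, by omega, by omega⟩
    rcases Nat.eq_zero_or_pos (q - l) with h0 | hpos
    · refine ⟨[l], by simpa using hl, by simp; omega, ?_⟩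
      calc 4 ^ (20 * [l].length) ≤ 4 ^ 60 := Nat.pow_le_pow_right (by norm_num) (by simp)
        _ ≤ 4 ^ 60 * q ^ 29 := Nat.le_mul_of_pos_right _ hq29
    · obtain ⟨L, hL, hs, hlen⟩ := ih (q - l) (by omega) hpos
      refine ⟨l :: L, ?_, ?_, ?_⟩
      · intro x hx
        rcases List.mem_cons.mp hx with rfl | hx
        exacts [hl, hL x hx]
      · rw [List.sum_cons, hs]
        omega
      · have h1 : 8 ^ 29 * (q - l) ^ 29 ≤ 3 ^ 29 * q ^ 29 := by
          rw [← mul_pow, ← mul_pow]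
          exact Nat.pow_le_pow_left hrem.2 29
        have h2 : 4 ^ 20 * (q - l) ^ 29 ≤ q ^ 29 := by
          have : 4 ^ 20 * 3 ^ 29 ≤ 8 ^ 29 := by norm_num
          apply Nat.le_of_mul_le_mul_left (c := _) _ (show 0 < 8 ^ 29 by norm_num)
          calc 8 ^ 29 * (4 ^ 20 * (q - l) ^ 29) = 4 ^ 20 * (8 ^ 29 * (q - l) ^ 29) := by ring
            _ ≤ 4 ^ 20 * (3 ^ 29 * q ^ 29) := Nat.mul_le_mul_left _ h1
            _ = 4 ^ 20 * 3 ^ 29 * q ^ 29 := by ring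
            _ ≤ _ := Nat.mul_le_mul_right _ this
        calc 4 ^ (20 * (l :: L).length) = 4 ^ 20 * 4 ^ (20 * L.length) := by
              rw [← pow_add, List.length_cons]; congr 1; ring
          _ ≤ 4 ^ 20 * (4 ^ 60 * (q - l) ^ 29) := Nat.mul_le_mul_left _ hlen
          _ = 4 ^ 60 * (4 ^ 20 * (q - l) ^ 29) := by ring
          _ ≤ _ := Nat.mul_le_mul_left _ h2

/-- The translation matrices give a representation of the group algebra by circulant matrices. -/
noncomputable def circulantHom (G : Type*) [AddCommGroup G] [Fintype G] [DecidableEq G] :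
    AddMonoidAlgebra ℤ G →ₐ[ℤ] Matrix G G ℤ :=
  AddMonoidAlgebra.lift ℤ (Matrix G G ℤ) G
    { toFun := fun g => circulant (Pi.single (Multiplicative.toAdd g) 1)
      map_one' := by simp
      map_mul' := fun g h => by
        rw [circulant_mul]
        congr 1
        ext i
        simp [Pi.single_apply, sub_eq_iff_eq_add] }

theorem circulantHom_single {G : Type*} [AddCommGroup G] [Fintype G] [DecidableEq G] (g : G) :
    circulantHom G (AddMonoidAlgebra.single g 1) = circulant (Pi.single g 1) := by
  simp [circulantHom]

theorem transpose_circulant_single {G : Type*} [AddCommGroup G] [DecidableEq G] (g : G) :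
    (circulant (Pi.single g (1 : ℤ)))ᵀ = circulant (Pi.single (-g) 1) := by
  rw [transpose_circulant]
  congr 1
  ext i
  simp [Pi.single_apply, neg_eq_iff_eq_neg]

/-- The coefficient list `l`, placed at positions `(p, s), (p, s + 1), …`. -/
def digitVec {m : ℕ} (p : ZMod 2) : ℕ → List ℤ → ZMod 2 × ZMod m → ℤ
  | _, [] => 0
  | s, c :: l => c • Pi.single (p, (s : ZMod m)) 1 + digitVec p (s + 1) l

theorem circulantHom_digit {m : ℕ} [NeZero m] (p : ZMod 2) (s : ℕ) (l : List ℤ) :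
    circulantHom (ZMod 2 × ZMod m) (AddMonoidAlgebra.single (p, (s : ZMod m)) 1 *
      listEval (AddMonoidAlgebra.single (0, 1) 1) l) = circulant (digitVec p s l) := by
  induction l generalizing s with
  | nil => simp [listEval, digitVec]
  | cons c l ih =>
    have h : (AddMonoidAlgebra.single (p, (s : ZMod m)) 1 * (AddMonoidAlgebra.single (0, 1) 1) :
        AddMonoidAlgebra ℤ (ZMod 2 × ZMod m)) =
        AddMonoidAlgebra.single (p, ((s + 1 : ℕ) : ZMod m)) 1 := by
      simp [AddMonoidAlgebra.single_mul_single]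
    rw [listEval, digitVec, circulant_add, circulant_smul, ← ih, ← h, ← circulantHom_single,
      ← map_zsmul, ← map_add]
    congr 1
    rw [zsmul_eq_mul]
    ring

theorem circulantHom_digit_transpose {m : ℕ} [NeZero m] (p : ZMod 2) (s : ℕ) (l : List ℤ) :
    circulantHom (ZMod 2 × ZMod m) (AddMonoidAlgebra.single (-(p, (s : ZMod m))) 1 *
      listEval (AddMonoidAlgebra.single (-(0, 1)) 1) l) = (circulant (digitVec p s l))ᵀ := by
  induction l generalizing s with
  | nil => simp [listEval, digitVec]
  | cons c l ih =>
    have h : (AddMonoidAlgebra.single (-(p, (s : ZMod m))) 1 *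
        (AddMonoidAlgebra.single (-(0, 1)) 1) : AddMonoidAlgebra ℤ (ZMod 2 × ZMod m)) =
        AddMonoidAlgebra.single (-(p, ((s + 1 : ℕ) : ZMod m))) 1 := by
      simp [AddMonoidAlgebra.single_mul_single, add_comm]
    rw [listEval, digitVec, circulant_add, circulant_smul, transpose_add, transpose_smul,
      transpose_circulant_single, ← ih, ← h, ← circulantHom_single, ← map_zsmul, ← map_add]
    congr 1
    rw [zsmul_eq_mul]
    ring

theorem IsGolayPair.circulant_add {a b : List ℤ} (h : IsGolayPair a b) {m : ℕ} [NeZero m]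
    (p p' : ZMod 2) (s : ℕ) :
    circulant (digitVec (m := m) p s a) * (circulant (digitVec p s a))ᵀ +
      circulant (digitVec p' s b) * (circulant (digitVec p' s b))ᵀ =
      (2 * a.length : ℤ) • 1 := by
  rw [← circulantHom_digit_transpose, ← circulantHom_digit_transpose, ← circulantHom_digit,
    ← circulantHom_digit, ← map_mul, ← map_mul, ← map_add]
  have hU : ∀ g : ZMod 2 × ZMod m, (AddMonoidAlgebra.single g 1 *
      AddMonoidAlgebra.single (-g) 1 : AddMonoidAlgebra ℤ (ZMod 2 × ZMod m)) = 1 := by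
    intro g
    rw [AddMonoidAlgebra.single_mul_single, add_neg_cancel, mul_one, AddMonoidAlgebra.one_def]
  have hg := h.complementary _ _ _ (hU (0, 1))
  rw [← map_one (circulantHom (ZMod 2 × ZMod m)), ← map_zsmul]
  congr 1
  rw [zsmul_eq_mul]
  push_cast
  have e1 := hU (p, (s : ZMod m))
  have e2 := hU (p', (s : ZMod m))
  linear_combination hg +
    (listEval (AddMonoidAlgebra.single (0, 1) 1) a *
      listEval (AddMonoidAlgebra.single (-(0, 1)) 1) a) * e1 +
    (listEval (AddMonoidAlgebra.single (0, 1) 1) b *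
      listEval (AddMonoidAlgebra.single (-(0, 1)) 1) b) * e2

theorem digitVec_support {m : ℕ} [NeZero m] {p : ZMod 2} {s : ℕ} {l : List ℤ}
    (hs : s + l.length ≤ m) {g : ZMod 2 × ZMod m} (hg : digitVec p s l g ≠ 0) :
    g.1 = p ∧ s ≤ g.2.val ∧ g.2.val < s + l.length := by
  induction l generalizing s with
  | nil => simp [digitVec] at hg
  | cons c l ih =>
    rw [List.length_cons] at hs ⊢
    by_cases h : g = (p, (s : ZMod m))
    · subst h
      rw [ZMod.val_natCast_of_lt (by omega)]
      exact ⟨rfl, le_rfl, by omega⟩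
    · have : digitVec p (s + 1) l g ≠ 0 := by
        simpa [digitVec, Pi.single_apply, h] using hg
      obtain ⟨h1, h2, h3⟩ := ih (by omega) this
      exact ⟨h1, by omega, by omega⟩

theorem digitVec_mem {m : ℕ} [NeZero m] (p : ZMod 2) {s : ℕ} {l : List ℤ}
    (hl : ∀ c ∈ l, c = 1 ∨ c = -1) (hs : s + l.length ≤ m) (g : ZMod 2 × ZMod m) :
    digitVec p s l g = 0 ∨ digitVec p s l g = 1 ∨ digitVec p s l g = -1 := by
  induction l generalizing s with
  | nil => simp [digitVec]
  | cons c l ih =>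
    rw [List.length_cons] at hs
    by_cases h : g = (p, (s : ZMod m))
    · subst h
      have h0 : digitVec p (s + 1) l (p, (s : ZMod m)) = 0 := by
        by_contra hne
        have := (digitVec_support (by omega) hne).2.1
        rw [ZMod.val_natCast_of_lt (by omega)] at this
        omega
      have := hl c List.mem_cons_self
      right
      simpa [digitVec, h0] using this
    · have := ih (s := s + 1) (fun c hc => hl c (List.mem_cons_of_mem _ hc)) (by omega)
      simpa [digitVec, Pi.single_apply, h] using this

/-- Disjointly supported sign vectors whose circulants have scalar total autocorrelation. -/
theorem exists_circulant_digits {m : ℕ} [NeZero m] (L : List ℕ)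
    (hL : ∀ l ∈ L, IsGolayLength l) (s : ℕ) (hs : s + L.sum ≤ m) :
    ∃ v : ℕ → ZMod 2 × ZMod m → ℤ,
      (∀ k g, v k g = 0 ∨ v k g = 1 ∨ v k g = -1) ∧
      (∀ k g, v k g ≠ 0 → s ≤ g.2.val ∧ g.2.val < s + L.sum) ∧
      (∀ k l g, v k g ≠ 0 → v l g ≠ 0 → k = l) ∧
      ∀ M, 2 * L.length ≤ M →
        ∑ k ∈ Finset.range M, circulant (v k) * (circulant (v k))ᵀ = (2 * L.sum : ℤ) • 1 := by
  induction L generalizing s with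
  | nil => exact ⟨0, by simp, by simp, by simp, by simp⟩
  | cons l L ih =>
    rw [List.sum_cons] at hs
    obtain ⟨v, h01, hsupp, hdisj, hsum⟩ :=
      ih (fun x hx => hL x (List.mem_cons_of_mem _ hx)) (s + l) (by omega)
    obtain ⟨a, b, hab, hla⟩ := hL l List.mem_cons_self
    have hlb : b.length = l := hab.length_eq ▸ hla
    have hsa : ∀ {g : ZMod 2 × ZMod m}, digitVec 0 s a g ≠ 0 →
        g.1 = 0 ∧ s ≤ g.2.val ∧ g.2.val < s + l := fun h => by
      rw [← hla]; exact digitVec_support (by omega) h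
    have hsb : ∀ {g : ZMod 2 × ZMod m}, digitVec 1 s b g ≠ 0 →
        g.1 = 1 ∧ s ≤ g.2.val ∧ g.2.val < s + l := fun h => by
      rw [← hlb]; exact digitVec_support (by omega) h
    refine ⟨fun k => match k with
      | 0 => digitVec 0 s a
      | 1 => digitVec 1 s b
      | k + 2 => v k, ?_, ?_, ?_, ?_⟩
    · rintro (_ | _ | k) g
      · exact digitVec_mem 0 hab.sign_left (by omega) g
      · exact digitVec_mem 1 hab.sign_right (by omega) g
      · exact h01 k g
    · rw [List.sum_cons]
      rintro (_ | _ | k) g hg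
      · have := hsa hg
        omega
      · have := hsb hg
        omega
      · have := hsupp k g hg
        omega
    · rintro (_ | _ | k) (_ | _ | k') g h1 h2
      · rfl
      · exact absurd ((hsa h1).1.symm.trans (hsb h2).1) (by decide)
      · have := hsa h1
        have := hsupp k' g h2
        omega
      · exact absurd ((hsa h2).1.symm.trans (hsb h1).1) (by decide)
      · rfl
      · have := hsb h1
        have := hsupp k' g h2
        omega
      · have := hsa h2
        have := hsupp k g h1
        omega
      · have := hsb h2
        have := hsupp k g h1
        omega
      · rw [hdisj k k' g h1 h2]
    · intro M hM
      rw [List.length_cons] at hM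
      obtain ⟨M, rfl⟩ : ∃ M', M = M' + 2 := ⟨M - 2, by omega⟩
      rw [Finset.sum_range_succ', Finset.sum_range_succ']
      simp only
      rw [hsum M (by omega), add_assoc, add_comm (circulant (digitVec 1 s b) * _),
        hab.circulant_add, hla, ← add_smul, List.sum_cons]
      congr 1
      push_cast
      ring

section

open scoped Kronecker

theorem zero_or_sign_sum {ι : Type*} [Fintype ι] [DecidableEq ι] {f : ι → ℤ}
    (h01 : ∀ k, f k = 0 ∨ f k = 1 ∨ f k = -1) (hdisj : ∀ k l, f k ≠ 0 → f l ≠ 0 → k = l) :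
    (∑ k, f k = 0 ∨ ∑ k, f k = 1 ∨ ∑ k, f k = -1) ∧ (∑ k, f k ≠ 0 → ∃ k, f k ≠ 0) := by
  constructor
  · by_cases h : ∃ k, f k ≠ 0
    · obtain ⟨k, hk⟩ := h
      rw [Finset.sum_eq_single k (fun l _ hl => by_contra fun h => hl (hdisj l k h hk)) (by simp)]
      exact h01 k
    · push Not at h
      exact Or.inl (Finset.sum_eq_zero fun k _ => h k)
  · intro hne
    obtain ⟨k, -, hk⟩ := Finset.exists_ne_zero_of_sum_ne_zero hne
    exact ⟨k, hk⟩

/-- Anticommuting matrices tensored with circulants sum to a matrix of square zero. -/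
theorem sum_kronecker_mul_self {ι V G : Type*} [Fintype ι] [Fintype V] [Fintype G]
    [AddCommGroup G] (α : ι → Matrix V V ℤ) (v : ι → G → ℤ)
    (hα : ∀ k l, α k * α l + α l * α k = 0) :
    (∑ k, α k ⊗ₖ circulant (v k)) * (∑ k, α k ⊗ₖ circulant (v k)) = 0 := by
  set N := ∑ k, α k ⊗ₖ circulant (v k) with hN
  have h1 : N * N = ∑ k, ∑ l, (α k * α l) ⊗ₖ (circulant (v k) * circulant (v l)) := by
    simp_rw [hN, Finset.sum_mul, Finset.mul_sum, mul_kronecker_mul]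
  have h2 : N * N = ∑ k, ∑ l, (α l * α k) ⊗ₖ (circulant (v k) * circulant (v l)) := by
    rw [h1, Finset.sum_comm]
    refine Finset.sum_congr rfl fun k _ => Finset.sum_congr rfl fun l _ => ?_
    rw [circulant_mul_comm]
  have h3 : N * N + N * N = 0 := by
    nth_rewrite 1 [h1]
    rw [h2, ← Finset.sum_add_distrib]
    refine Finset.sum_eq_zero fun k _ => ?_
    rw [← Finset.sum_add_distrib]
    refine Finset.sum_eq_zero fun l _ => ?_
    rw [← add_kronecker, hα, kroneckerMap_zero_left _ zero_mul]
  ext i j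
  have := congrFun (congrFun h3 i) j
  simp only [Matrix.add_apply, Matrix.zero_apply] at this ⊢
  omega

theorem sum_kronecker_mul_transpose {ι V G : Type*} [Fintype ι] [DecidableEq ι] [Fintype V]
    [DecidableEq V] [Fintype G] [DecidableEq G]
    [AddCommGroup G] (α : ι → Matrix V V ℤ) (v : ι → G → ℤ) {c d : ℤ}
    (hα : ∀ k l, α k * (α l)ᵀ + (α l)ᵀ * α k = if k = l then c • 1 else 0)
    (hv : ∑ k, circulant (v k) * (circulant (v k))ᵀ = d • 1) :
    (∑ k, α k ⊗ₖ circulant (v k)) * (∑ k, α k ⊗ₖ circulant (v k))ᵀ +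
      (∑ k, α k ⊗ₖ circulant (v k))ᵀ * (∑ k, α k ⊗ₖ circulant (v k)) =
      (c * d) • 1 := by
  have hcomm : ∀ k l, (circulant (v l))ᵀ * circulant (v k) =
      circulant (v k) * (circulant (v l))ᵀ := fun k l => by
    rw [transpose_circulant, circulant_mul_comm]
  have h1 : (∑ k, α k ⊗ₖ circulant (v k)) *
      (∑ k, α k ⊗ₖ circulant (v k))ᵀ =
      ∑ k, ∑ l, (α k * (α l)ᵀ) ⊗ₖ (circulant (v k) * (circulant (v l))ᵀ) := by
    simp_rw [transpose_sum, Finset.sum_mul, Finset.mul_sum, ← kroneckerMap_transpose,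
      mul_kronecker_mul]
  have h2 : (∑ k, α k ⊗ₖ circulant (v k))ᵀ *
      (∑ k, α k ⊗ₖ circulant (v k)) =
      ∑ k, ∑ l, ((α l)ᵀ * α k) ⊗ₖ (circulant (v k) * (circulant (v l))ᵀ) := by
    simp_rw [transpose_sum, Finset.sum_mul, Finset.mul_sum, ← kroneckerMap_transpose]
    rw [Finset.sum_comm]
    exact Finset.sum_congr rfl fun k _ => Finset.sum_congr rfl fun l _ => by
      rw [← hcomm, mul_kronecker_mul]
  rw [h1, h2, ← Finset.sum_add_distrib]
  simp_rw [← Finset.sum_add_distrib, ← add_kronecker, hα]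
  calc ∑ k, ∑ l, (if k = l then c • (1 : Matrix V V ℤ) else 0) ⊗ₖ
        (circulant (v k) * (circulant (v l))ᵀ) =
      ∑ k, (c • (1 : Matrix V V ℤ)) ⊗ₖ (circulant (v k) * (circulant (v k))ᵀ) := by
        refine Finset.sum_congr rfl fun k _ => ?_
        rw [Finset.sum_eq_single k]
        · simp
        · intro l _ hl
          simp [Ne.symm hl]
        · simp
    _ = (c • (1 : Matrix V V ℤ)) ⊗ₖ (∑ k, circulant (v k) * (circulant (v k))ᵀ) :=
        (map_sum (kroneckerBilinear (R := ℤ) (c • (1 : Matrix V V ℤ))) _ _).symm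
    _ = (c * d) • 1 := by
        rw [hv, smul_kronecker, kronecker_smul, one_kronecker_one, smul_smul]

/-- A skew weighing matrix of large weight whose order has a large power of two as a factor. -/
theorem exists_skew_weighing (h q : ℕ) (L : List ℕ) (hL : ∀ l ∈ L, IsGolayLength l)
    (hsum : L.sum = q) (hlen : L.length ≤ h) :
    ∃ S : Matrix (Finset (Fin (2 * h + 1)) × ZMod 2 × ZMod (2 * q + 1))
        (Finset (Fin (2 * h + 1)) × ZMod 2 × ZMod (2 * q + 1)) ℤ,
      Sᵀ = -S ∧ (∀ i j, S i j = 0 ∨ S i j = 1 ∨ S i j = -1) ∧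
      S.det = (2 ^ (2 * h + 2) * (2 * q)) ^ (2 ^ (2 * h + 1) * (2 * q + 1)) := by
  obtain ⟨α, hsign, hanti, hcar⟩ := exists_sign_car h
  obtain ⟨v, h01, hsupp, hdisj, hv⟩ := exists_circulant_digits (m := 2 * q + 1) L hL 1 (by omega)
  have hv' := hv (2 * h + 1) (by omega)
  rw [← Fin.sum_univ_eq_sum_range (fun k => circulant (v k) * (circulant (v k))ᵀ), hsum] at hv'
  set N := ∑ k : Fin (2 * h + 1), α k ⊗ₖ circulant (v k) with hN
  have hNN : N * N = 0 := sum_kronecker_mul_self α (fun k => v k) hanti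
  have hNT : N * Nᵀ + Nᵀ * N = (2 ^ (2 * h + 2) * (2 * q) : ℤ) • 1 :=
    sum_kronecker_mul_transpose α (fun k => v k) hcar hv'
  have hskew : (N - Nᵀ)ᵀ = -(N - Nᵀ) := by simp
  have hent : ∀ i j, (N i j = 0 ∨ N i j = 1 ∨ N i j = -1) ∧
      (N i j ≠ 0 → 1 ≤ (i.2.2 - j.2.2).val ∧ (i.2.2 - j.2.2).val ≤ q) := by
    intro i j
    have hNij : N i j = ∑ k : Fin (2 * h + 1), α k i.1 j.1 * v k (i.2 - j.2) := by
      rw [hN, Matrix.sum_apply]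
      rfl
    have hne : ∀ k : Fin (2 * h + 1), α k i.1 j.1 * v k (i.2 - j.2) ≠ 0 → v k (i.2 - j.2) ≠ 0 :=
      fun k => right_ne_zero_of_mul
    obtain ⟨h1, h2⟩ := zero_or_sign_sum (f := fun k : Fin (2 * h + 1) =>
      α k i.1 j.1 * v k (i.2 - j.2)) (fun k => by
        rcases hsign k i.1 j.1 with h1 | h1 <;>
        rcases h01 k (i.2 - j.2) with h2 | h2 | h2 <;> simp [h1, h2])
      (fun k l hk hl => Fin.ext (hdisj _ _ _ (hne k hk) (hne l hl)))
    rw [hNij]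
    refine ⟨h1, fun h => ?_⟩
    obtain ⟨k, hk⟩ := h2 h
    have := hsupp k _ (hne k hk)
    rw [hsum, Prod.snd_sub] at this
    omega
  refine ⟨N - Nᵀ, hskew, fun i j => ?_, ?_⟩
  · obtain ⟨h1, h2⟩ := hent i j
    obtain ⟨h3, h4⟩ := hent j i
    rw [Matrix.sub_apply, transpose_apply]
    have hz : N i j = 0 ∨ N j i = 0 := by
      by_contra! hne
      have h5 := h2 hne.1
      have h6 := h4 hne.2
      rw [← neg_sub, ZMod.neg_val] at h6
      split_ifs at h6 <;> omega
    omega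
  · set S := N - Nᵀ
    have hSS : S * Sᵀ = (2 ^ (2 * h + 2) * (2 * q) : ℤ) • 1 := by
      have hTT : Nᵀ * Nᵀ = 0 := by rw [← transpose_mul, hNN, transpose_zero]
      rw [hskew, ← hNT, mul_neg, Matrix.sub_mul, Matrix.mul_sub, Matrix.mul_sub, hNN, hTT]
      abel
    have hdet := congrArg det hSS
    rw [det_mul, det_transpose, det_smul, det_one, mul_one] at hdet
    have hcard : Fintype.card (Finset (Fin (2 * h + 1)) × ZMod 2 × ZMod (2 * q + 1)) =
        2 ^ (2 * h + 1) * (2 * q + 1) * 2 := by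
      simp only [Fintype.card_prod, Fintype.card_finset, Fintype.card_fin, ZMod.card]
      ring
    rw [hcard, pow_mul, ← sq] at hdet
    exact (sq_eq_sq₀ (int_det_nonneg_of_skew hskew) (by positivity)).mp hdet

/-- Seidel matrices of large determinant obtained from skew weighing matrices by padding. -/
theorem exists_seidel_det_ge_pow (h q t : ℕ) (L : List ℕ) (hL : ∀ l ∈ L, IsGolayLength l)
    (hsum : L.sum = q) (hlen : L.length ≤ h) {n : ℕ}
    (hn : n = 2 ^ (2 * h + 2) * (2 * q + 1) + 2 * t) :
    ∃ S : Matrix (Fin n) (Fin n) ℤ, IsSeidel S ∧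
      (2 ^ (2 * h + 2) * (2 * q)) ^ (2 ^ (2 * h + 1) * (2 * q + 1)) ≤ S.det := by
  obtain ⟨W, hskew, h01, hdet⟩ := exists_skew_weighing h q L hL hsum hlen
  have hJ : (J (Fin t) ℤ).det = 1 := by
    have h1 := J_det_mul_J_det (Fin t) ℤ
    have h2 := int_det_nonneg_of_skew (J_transpose (Fin t) ℤ)
    nlinarith
  have hJ01 : ∀ i j, J (Fin t) ℤ i j = 0 ∨ J (Fin t) ℤ i j = 1 ∨ J (Fin t) ℤ i j = -1 := by
    rintro (i | i) (j | j) <;> simp [J, one_apply] <;> tauto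
  let e : (Finset (Fin (2 * h + 1)) × ZMod 2 × ZMod (2 * q + 1)) ⊕ (Fin t ⊕ Fin t) ≃ Fin n :=
    Fintype.equivOfCardEq (by
      simp only [Fintype.card_sum, Fintype.card_prod, Fintype.card_finset, Fintype.card_fin,
        ZMod.card, hn]
      ring)
  set M := reindex e e (fromBlocks W 0 0 (J (Fin t) ℤ)) with hM
  have hMdet : M.det = (2 ^ (2 * h + 2) * (2 * q)) ^ (2 ^ (2 * h + 1) * (2 * q + 1)) := by
    rw [hM, det_reindex_self, det_fromBlocks_zero₂₁, hdet, hJ, mul_one]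
  rw [← hMdet]
  apply exists_seidel_det_ge
  · rw [hM, transpose_reindex, fromBlocks_transpose, hskew, J_transpose, transpose_zero,
      transpose_zero]
    ext i j
    rcases hi : e.symm i with a | a <;> rcases hj : e.symm j with b | b <;> simp [hi, hj]
  · intro i j
    simp only [hM, reindex_apply, submatrix_apply]
    rcases e.symm i with a | a <;> rcases e.symm j with b | b
    · exact h01 a b
    · simp
    · simp
    · exact hJ01 a b

end

/-- The arithmetic behind the choice of parameters: few Golay digits suffice. -/
theorem golay_count_le {n x : ℝ} {D q r h : ℕ} (hn : 2 ^ 900 ≤ n) (hx : 0 < x)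
    (hxn : x ^ 5 = n ^ 3) (hD : D = 4 ^ (h + 1)) (hxD : x < 16 * D) (hqn : (2 * q * D : ℝ) ≤ n)
    (hr : 4 ^ (20 * r) ≤ 4 ^ 60 * q ^ 29) : r ≤ h := by
  by_contra! hlt
  have hn0 : 0 < n := lt_of_lt_of_le (by positivity) hn
  have h1 : (D : ℝ) ^ 20 ≤ 4 ^ 60 * q ^ 29 := by
    have : D ^ 20 ≤ 4 ^ 60 * q ^ 29 := by
      refine le_trans ?_ hr
      rw [hD, ← pow_mul]
      exact Nat.pow_le_pow_right (by norm_num) (by omega)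
    exact_mod_cast this
  have h2 : q * x ≤ 8 * n := by nlinarith [(Nat.cast_nonneg q : (0 : ℝ) ≤ q)]
  have h3 : x ^ 20 ≤ 16 ^ 20 * (4 ^ 60 * q ^ 29) := by
    calc x ^ 20 ≤ (16 * D) ^ 20 := by gcongr
      _ = 16 ^ 20 * (D : ℝ) ^ 20 := by rw [mul_pow]
      _ ≤ _ := by gcongr
  have h4 : x ^ 49 ≤ 2 ^ 287 * n ^ 29 := by
    calc x ^ 49 = x ^ 20 * x ^ 29 := by ring
      _ ≤ 16 ^ 20 * (4 ^ 60 * q ^ 29) * x ^ 29 := by gcongr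
      _ = 16 ^ 20 * 4 ^ 60 * (q * x) ^ 29 := by ring
      _ ≤ 16 ^ 20 * 4 ^ 60 * (8 * n) ^ 29 := by gcongr
      _ = 2 ^ 287 * n ^ 29 := by
        rw [mul_pow, show (16 : ℝ) = 2 ^ 4 by norm_num, show (4 : ℝ) = 2 ^ 2 by norm_num,
          show (8 : ℝ) = 2 ^ 3 by norm_num, ← pow_mul, ← pow_mul, ← pow_mul, ← mul_assoc,
          ← pow_add, ← pow_add]
  have h5 : n ^ 145 * n ^ 2 ≤ n ^ 145 * 2 ^ 1435 := by
    calc n ^ 145 * n ^ 2 = (n ^ 3) ^ 49 := by rw [← pow_add, ← pow_mul]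
      _ = (x ^ 49) ^ 5 := by rw [← hxn, ← pow_mul, ← pow_mul]
      _ ≤ (2 ^ 287 * n ^ 29) ^ 5 := by gcongr
      _ = n ^ 145 * 2 ^ 1435 := by rw [mul_pow, ← pow_mul, ← pow_mul, mul_comm]
  have h6 : n ^ 2 ≤ 2 ^ 1435 := le_of_mul_le_mul_left h5 (by positivity)
  have h7 : ((2 : ℝ) ^ 900) ^ 2 ≤ 2 ^ 1435 := le_trans (by gcongr) h6
  rw [← pow_mul] at h7
  exact absurd ((pow_le_pow_iff_right₀ one_lt_two).mp h7) (by norm_num)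

/-- there is an `N` such that for every even `n ≥ N` some Seidel
matrix `S` of order `n` has `det S ≥ (n - n^0.6)^((n - n^0.6 + 1)/2)`
(real powers). -/
theorem seidel_det_superexponential :
    ∃ N : ℕ, ∀ n : ℕ, N ≤ n → Even n →
      ∃ S : Matrix (Fin n) (Fin n) ℤ, IsSeidel S ∧
        ((n : ℝ) - (n : ℝ) ^ (0.6 : ℝ)) ^
            ((((n : ℝ) - (n : ℝ) ^ (0.6 : ℝ)) + 1) / 2) ≤ (S.det : ℝ) := by
  refine ⟨2 ^ 900, fun n hN hn2 => ?_⟩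
  have hn : (2 : ℝ) ^ 900 ≤ n := by exact_mod_cast hN
  have hn0 : (0 : ℝ) < n := lt_of_lt_of_le (by positivity) hn
  set x : ℝ := (n : ℝ) ^ (0.6 : ℝ) with hx
  have hx0 : 0 < x := Real.rpow_pos_of_pos hn0 _
  have hxn : x ^ 5 = (n : ℝ) ^ 3 := by
    rw [hx, ← Real.rpow_natCast, ← Real.rpow_mul hn0.le, ← Real.rpow_natCast]
    norm_num
  have hx16 : 16 ≤ x := by
    refine le_of_pow_le_pow_left₀ (n := 5) (by norm_num) hx0.le ?_
    rw [hxn]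
    calc (16 : ℝ) ^ 5 = (2 ^ 10) ^ 2 := by norm_num
      _ ≤ (2 ^ 900) ^ 3 := by
        rw [← pow_mul, ← pow_mul]
        exact pow_le_pow_right₀ one_le_two (by norm_num)
      _ ≤ (n : ℝ) ^ 3 := by gcongr
  have hx2 : 2 * x ≤ n := by
    refine le_of_pow_le_pow_left₀ (n := 5) (by norm_num) hn0.le ?_
    rw [mul_pow, hxn]
    have : (2 : ℝ) ^ 5 ≤ (n : ℝ) ^ 2 := by
      calc (2 : ℝ) ^ 5 ≤ (2 ^ 900) ^ 2 := by
            rw [← pow_mul]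
            exact pow_le_pow_right₀ one_le_two (by norm_num)
        _ ≤ (n : ℝ) ^ 2 := by gcongr
    calc (2 : ℝ) ^ 5 * (n : ℝ) ^ 3 ≤ (n : ℝ) ^ 2 * (n : ℝ) ^ 3 := by gcongr
      _ = (n : ℝ) ^ 5 := by ring
  obtain ⟨k, hk1, hk2⟩ := exists_nat_pow_near (y := (4 : ℝ)) (by linarith : 1 ≤ x) (by norm_num)
  obtain ⟨h, rfl⟩ : ∃ h, k = h + 2 := by
    refine ⟨k - 2, ?_⟩
    have : 2 < k + 1 := by
      by_contra! hle
      have : (4 : ℝ) ^ (k + 1) ≤ 4 ^ 2 := pow_le_pow_right₀ (by norm_num) hle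
      linarith
    omega
  obtain ⟨D, hD⟩ : ∃ D : ℕ, D = 4 ^ (h + 1) := ⟨_, rfl⟩
  have hDR : (D : ℝ) = 4 ^ (h + 1) := by rw [hD]; push_cast; rfl
  have hD2 : D = 2 ^ (2 * h + 2) := by
    rw [hD, show 4 = 2 ^ 2 by norm_num, ← pow_mul]
    congr 1
  have hxD1 : 4 * (D : ℝ) ≤ x := by rw [hDR]; linarith [pow_succ (4 : ℝ) (h + 1)]
  have hxD2 : x < 16 * D := by
    rw [hDR]
    linarith [pow_succ (4 : ℝ) (h + 1), pow_succ (4 : ℝ) (h + 2)]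
  have hD0 : 0 < D := by rw [hD]; positivity
  have hDn : D * 3 ≤ n := by
    have hD0R : (0 : ℝ) < D := by exact_mod_cast hD0
    have : (D : ℝ) * 3 ≤ n := by linarith only [hxD1, hx2, hx16, hD0R]
    exact_mod_cast this
  obtain ⟨q, hq1, hq2, hq0⟩ : ∃ q, D * (2 * q + 1) ≤ n ∧ n < D * (2 * q + 3) ∧ 0 < q := by
    have h3 : 3 ≤ n / D := (Nat.le_div_iff_mul_le hD0).mpr (by linarith)
    refine ⟨(n / D - 1) / 2, ?_, ?_, by omega⟩
    · calc D * (2 * ((n / D - 1) / 2) + 1) ≤ D * (n / D) := Nat.mul_le_mul_left _ (by omega)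
        _ ≤ n := Nat.mul_div_le n D
    · calc n < D * (n / D + 1) := Nat.lt_mul_div_succ n hD0
        _ ≤ _ := Nat.mul_le_mul_left _ (by omega)
  obtain ⟨L, hL, hsum, hlen⟩ := exists_golay_sum q hq0
  have hq1R : (D : ℝ) * (2 * q + 1) ≤ n := by exact_mod_cast hq1
  have hq2R : (n : ℝ) < D * (2 * q + 3) := by exact_mod_cast hq2
  have hD1R : (1 : ℝ) ≤ D := by exact_mod_cast hD0
  have hLh : L.length ≤ h := golay_count_le hn hx0 hxn hD hxD2 (by linarith) hlen
  obtain ⟨t, ht⟩ : ∃ t, n = D * (2 * q + 1) + 2 * t := by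
    have hDe : Even D := by
      rw [hD2]
      exact (Nat.even_pow.mpr ⟨even_two, by omega⟩)
    obtain ⟨t, ht⟩ := (Nat.even_sub hq1).mpr (iff_of_true hn2 (hDe.mul_right _))
    exact ⟨t, by omega⟩
  obtain ⟨S, hS, hdet⟩ := exists_seidel_det_ge_pow h q t L hL hsum hLh (n := n) (hD2 ▸ ht)
  refine ⟨S, hS, ?_⟩
  have hdetR : ((D : ℝ) * (2 * q)) ^ (2 ^ (2 * h + 1) * (2 * q + 1)) ≤ (S.det : ℝ) := by
    rw [hD2]
    exact_mod_cast hdet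
  refine le_trans ?_ hdetR
  have hw : (n : ℝ) - x ≤ D * (2 * q) := by linarith
  have hw1 : 1 ≤ (D : ℝ) * (2 * q) := by linarith only [hw, hx2, hx16]
  rw [← Real.rpow_natCast]
  have hexp : ((n : ℝ) - x + 1) / 2 ≤ ((2 ^ (2 * h + 1) * (2 * q + 1) : ℕ) : ℝ) := by
    have : (D : ℝ) = 2 * 2 ^ (2 * h + 1) := by
      rw [hD2, pow_succ 2 (2 * h + 1)]
      push_cast
      ring
    push_cast
    have h2 : (2 : ℝ) ^ (2 * h + 1) * (2 * q + 1) = D * (2 * q + 1) / 2 := by rw [this]; ring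
    rw [h2]
    linarith
  calc ((n : ℝ) - x) ^ (((n : ℝ) - x + 1) / 2) ≤
        ((D : ℝ) * (2 * q)) ^ (((n : ℝ) - x + 1) / 2) :=
        Real.rpow_le_rpow (by linarith only [hx2, hx16]) hw (by linarith only [hx2, hx16])
    _ ≤ _ := Real.rpow_le_rpow_of_exponent_le hw1 hexp
end

section
/- Let n ≥ 2 be an even integer and suppose S is a skew-conference matrix of order n+2 (a Seidel matrix with S·Sᵀ = (n+1)·I). Then the n×n matrix obtained from S by deleting any two rows and the corresponding two columns has determinant (n+1)^((n−2)/2). -/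
open Matrix

/-- The determinant of a real skew-symmetric matrix is nonnegative. -/
theorem Matrix.det_nonneg_of_transpose_eq_neg {m : Type*} [Fintype m] [DecidableEq m]
    {A : Matrix m m ℝ} (hA : Aᵀ = -A) : 0 ≤ A.det := by
  by_contra! hneg
  let f : ℝ → ℝ := fun t => (A + t • (1 - A)).det
  have hf : Continuous f := by
    apply Continuous.matrix_det
    fun_prop
  have h0 : f 0 < 0 := by simpa [f] using hneg
  have h1 : f 1 = 1 := by simp [f]
  obtain ⟨t, ht, hft⟩ := intermediate_value_Icc zero_le_one hf.continuousOn
    (show (0 : ℝ) ∈ Set.Icc (f 0) (f 1) from ⟨h0.le, by simp [h1]⟩)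
  have ht0 : t ≠ 0 := by
    rintro rfl
    exact h0.ne hft
  obtain ⟨v, hv, hv0⟩ := Matrix.exists_mulVec_eq_zero_iff.mpr hft
  have hskew : v ⬝ᵥ A *ᵥ v = 0 := by
    have h : v ⬝ᵥ A *ᵥ v = v ⬝ᵥ Aᵀ *ᵥ v := by
      rw [mulVec_transpose, dotProduct_comm v (v ᵥ* A), dotProduct_mulVec]
    rw [hA, neg_mulVec, dotProduct_neg] at h
    linarith
  have h := congrArg (v ⬝ᵥ ·) hv0
  simp only [add_mulVec, smul_mulVec, sub_mulVec, one_mulVec, dotProduct_add, dotProduct_smul,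
    dotProduct_sub, hskew, dotProduct_zero, smul_eq_mul, sub_zero, zero_add, mul_eq_zero,
    dotProduct_self_eq_zero] at h
  exact h.elim ht0 hv

/-- Jacobi's identity for complementary minors of a matrix with `M * Mᵀ = q • 1`. -/
theorem Matrix.det_mul_det_toBlocks₂₂_of_mul_transpose_eq_smul {m k R : Type*} [Fintype m]
    [DecidableEq m] [Fintype k] [DecidableEq k] [CommRing R] {M : Matrix (m ⊕ k) (m ⊕ k) R} {q : R}
    (h : M * Mᵀ = q • (1 : Matrix (m ⊕ k) (m ⊕ k) R)) :
    M.det * M.toBlocks₂₂.det = q ^ Fintype.card k * M.toBlocks₁₁.det := by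
  have hM := fromBlocks_toBlocks M
  set A := M.toBlocks₁₁
  set B := M.toBlocks₁₂
  set C := M.toBlocks₂₁
  set D := M.toBlocks₂₂
  rw [← hM, fromBlocks_transpose, fromBlocks_multiply, ← fromBlocks_one, fromBlocks_smul,
    fromBlocks_inj] at h
  obtain ⟨-, h₁₂, -, h₂₂⟩ := h
  have hprod : fromBlocks A B C D * fromBlocks 1 Cᵀ 0 Dᵀ =
      fromBlocks A 0 C (q • (1 : Matrix k k R)) := by
    rw [fromBlocks_multiply, h₁₂, h₂₂]
    simp
  have hdet := congrArg det hprod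
  rw [det_mul, det_fromBlocks_zero₂₁, det_fromBlocks_zero₁₂, hM, det_one, one_mul, det_transpose,
    det_smul, det_one, mul_one] at hdet
  rw [hdet, mul_comm]

/-- The determinant of a skew-conference matrix of order `n`. -/
theorem IsSeidel.det_eq_pow {n k : ℕ} {S : Matrix (Fin n) (Fin n) ℤ} (hS : IsSeidel S)
    (hn : n = k * 2) {q : ℤ} (hq : 0 ≤ q)
    (hconf : S * Sᵀ = q • (1 : Matrix (Fin n) (Fin n) ℤ)) : S.det = q ^ k := by
  have hnonneg : 0 ≤ S.det := by
    have h : 0 ≤ (S.map (Int.castRingHom ℝ)).det := by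
      apply det_nonneg_of_transpose_eq_neg
      rw [← transpose_map, hS.2.2]
      ext i j
      simp
    rw [← RingHom.mapMatrix_apply, ← RingHom.map_det] at h
    rw [eq_intCast] at h
    exact_mod_cast h
  have h := congrArg det hconf
  rw [det_mul, det_transpose, det_smul, det_one, mul_one, Fintype.card_fin, ← sq,
    show q ^ n = (q ^ k) ^ 2 by rw [hn, pow_mul]] at h
  exact (pow_left_inj₀ hnonneg (pow_nonneg hq k) two_ne_zero).mp h

/-- An injection from `m` into `ι` extends to an equivalence from `m ⊕ k` onto `ι` when the
cardinalities match. -/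
theorem Function.Injective.exists_sum_equiv {m k ι : Type*} [Fintype m] [Fintype k] [Fintype ι]
    {e : m → ι} (he : Function.Injective e)
    (hcard : Fintype.card ι = Fintype.card m + Fintype.card k) :
    ∃ σ : m ⊕ k ≃ ι, ∀ i, σ (Sum.inl i) = e i := by
  classical
  have hk : Fintype.card k = Fintype.card ↥(Set.range e)ᶜ := by
    rw [Fintype.card_compl_set, Set.card_range_of_injective he, hcard, Nat.add_sub_cancel_left]
  exact ⟨((Equiv.ofInjective e he).sumCongr (Fintype.equivOfCardEq hk)).trans
    (Equiv.Set.sumCompl (Set.range e)), fun i => by simp⟩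

/-- deleting any two rows and the corresponding two columns of a
skew-conference matrix of order `n + 2` (here `n ≥ 2` is even) yields an
`n × n` matrix of determinant `(n+1)^((n-2)/2)`.  Deleting two rows/columns is
expressed by taking the principal submatrix along any injection
`Fin n ↪ Fin (n+2)`. -/
theorem det_skew_conference_delete_two (n : ℕ) (hn : 2 ≤ n) (hne : Even n)
    (S : Matrix (Fin (n + 2)) (Fin (n + 2)) ℤ) (hS : IsSeidel S)
    (hconf : S * Sᵀ = ((n : ℤ) + 1) • (1 : Matrix (Fin (n + 2)) (Fin (n + 2)) ℤ))
    (e : Fin n → Fin (n + 2)) (he : Function.Injective e) :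
    (S.submatrix e e).det = ((n : ℤ) + 1) ^ ((n - 2) / 2) := by
  obtain ⟨k, hk⟩ := hne
  obtain ⟨σ, hσ⟩ := he.exists_sum_equiv (k := Fin 2) (by simp)
  have hq : (0 : ℤ) < (n : ℤ) + 1 := by positivity
  have hdet : S.det = ((n : ℤ) + 1) ^ (k + 1) := hS.det_eq_pow (by omega) hq.le hconf
  have hblock := det_mul_det_toBlocks₂₂_of_mul_transpose_eq_smul
    (M := S.submatrix σ σ) (q := (n : ℤ) + 1) (by
      rw [transpose_submatrix, submatrix_mul_equiv, hconf]
      change ((n : ℤ) + 1) • (1 : Matrix _ _ ℤ).submatrix σ σ = _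
      rw [submatrix_one_equiv])
  have h₁₁ : (S.submatrix σ σ).toBlocks₁₁ = S.submatrix e e := by
    ext i j
    simp [toBlocks₁₁, hσ]
  have h₂₂ : (S.submatrix σ σ).toBlocks₂₂.det = 1 := by
    have hskew : S (σ (Sum.inr 1)) (σ (Sum.inr 0)) = -S (σ (Sum.inr 0)) (σ (Sum.inr 1)) :=
      congrFun (congrFun hS.2.2 _) _
    have hone := hS.2.1 (σ (Sum.inr 0)) (σ (Sum.inr 1)) (by simp)
    rw [det_fin_two]
    simp only [toBlocks₂₂, of_apply, submatrix_apply, hS.1, hskew]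
    rcases hone with h | h <;> simp [h]
  rw [h₁₁, h₂₂, det_submatrix_equiv_self, hdet, mul_one, Fintype.card_fin,
    show k + 1 = 2 + (n - 2) / 2 by omega, pow_add] at hblock
  exact (mul_left_cancel₀ (pow_ne_zero 2 hq.ne') hblock).symm
end

section
/- Let n be an even positive integer and S a Seidel matrix of order n which is not a skew-conference matrix, i.e., S·Sᵀ ≠ (n−1)·I. Then (det S)² ≤ (n−1)^(n−2) · ((n−1)² − 4). -/
open Matrix

/-- **Hadamard's inequality**: the squared determinant of a real matrix is at most the product of
the squared Euclidean norms of its rows. -/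
theorem Matrix.det_sq_le_prod_dotProduct_self {n : ℕ} (M : Matrix (Fin n) (Fin n) ℝ) :
    M.det ^ 2 ≤ ∏ i, M i ⬝ᵥ M i := by
  have : Fact (Module.finrank ℝ (EuclideanSpace ℝ (Fin n)) = n) := ⟨by simp⟩
  let b := EuclideanSpace.basisFun (Fin n) ℝ
  let v : Fin n → EuclideanSpace ℝ (Fin n) := fun i => WithLp.toLp 2 (M i)
  have hdet : b.toBasis.det v = M.det := by
    rw [Module.Basis.det_apply, ← Matrix.det_transpose M]
    rfl
  have hle := b.toBasis.orientation.abs_volumeForm_apply_le v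
  rw [Orientation.volumeForm_robust' _ b, hdet] at hle
  calc M.det ^ 2 = |M.det| ^ 2 := (sq_abs _).symm
    _ ≤ (∏ i, ‖v i‖) ^ 2 := by gcongr
    _ = ∏ i, M i ⬝ᵥ M i := by
      rw [← Finset.prod_pow]
      simp [EuclideanSpace.real_norm_sq_eq, v, dotProduct, ← pow_two]

/-- A refinement of Hadamard's inequality for matrices whose rows all have squared norm `r`, taking
into account the inner product of two of the rows. -/
theorem Matrix.det_sq_le_of_dotProduct_self_eq {n : ℕ} (M : Matrix (Fin n) (Fin n) ℝ) {r : ℝ}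
    (hr : 0 < r) (hM : ∀ i, M i ⬝ᵥ M i = r) {i j : Fin n} (hij : i ≠ j) :
    M.det ^ 2 ≤ r ^ (n - 2) * (r ^ 2 - (M i ⬝ᵥ M j) ^ 2) := by
  have hn : 2 ≤ n := by
    have := Fin.val_ne_of_ne hij
    omega
  set g := M i ⬝ᵥ M j with hg
  rw [← Matrix.det_updateRow_add_smul_self M hij (-(g / r))]
  refine (Matrix.det_sq_le_prod_dotProduct_self _).trans_eq ?_
  rw [← Finset.mul_prod_erase _ _ (Finset.mem_univ i), Finset.prod_congr rfl (g := fun _ => r)]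
  · have hji : M j ⬝ᵥ M i = g := dotProduct_comm _ _
    simp only [updateRow_self, add_dotProduct, dotProduct_add, smul_dotProduct, dotProduct_smul,
      smul_eq_mul, hM, hji, ← hg, Finset.prod_const, Finset.card_erase_of_mem (Finset.mem_univ i),
      Finset.card_univ, Fintype.card_fin]
    obtain ⟨m, rfl⟩ := Nat.exists_eq_add_of_le hn
    rw [show 2 + m - 1 = m + 1 by omega, show 2 + m - 2 = m by omega]
    field_simp
    ring
  · intro k hk
    rw [updateRow_ne (Finset.ne_of_mem_erase hk), hM]

namespace IsSeidel

variable {n : ℕ} {S : Matrix (Fin n) (Fin n) ℤ}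

theorem dotProduct_self (hS : IsSeidel S) (i : Fin n) : S i ⬝ᵥ S i = (n : ℤ) - 1 := by
  have h : ∀ k, S i k * S i k = 1 - if i = k then 1 else 0 := by
    intro k
    split_ifs with hik
    · simp [← hik, hS.1 i]
    · rcases hS.2.1 i k hik with h | h <;> simp [h]
  simp [dotProduct, h]

theorem even_dotProduct (hS : IsSeidel S) (hn : Even n) {i j : Fin n} (hij : i ≠ j) :
    Even (S i ⬝ᵥ S j) := by
  have h : ∀ i k, (S i k : ZMod 2) = 1 - if i = k then 1 else 0 := by
    intro i k
    split_ifs with hik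
    · simp [← hik, hS.1 i]
    · rcases hS.2.1 i k hik with h | h <;> simp [h]
  rw [← ZMod.intCast_eq_zero_iff_even]
  simp [dotProduct, h, mul_sub, hij, (ZMod.natCast_eq_zero_iff_even).2 hn]

end IsSeidel

/-- a Seidel matrix of even positive order `n` that is not a
skew-conference matrix satisfies `(det S)² ≤ (n-1)^(n-2) · ((n-1)² - 4)`. -/
theorem det_sq_le_of_not_skew_conference (n : ℕ) (hn : 0 < n) (hne : Even n)
    (S : Matrix (Fin n) (Fin n) ℤ) (hS : IsSeidel S)
    (hnc : S * Sᵀ ≠ ((n : ℤ) - 1) • (1 : Matrix (Fin n) (Fin n) ℤ)) :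
    S.det ^ 2 ≤ ((n : ℤ) - 1) ^ (n - 2) * (((n : ℤ) - 1) ^ 2 - 4) := by
  obtain ⟨i, j, hij, hne0⟩ : ∃ i j, i ≠ j ∧ S i ⬝ᵥ S j ≠ 0 := by
    contrapose! hnc
    ext i j
    change S i ⬝ᵥ S j = _
    rcases eq_or_ne i j with rfl | hij
    · simp [hS.dotProduct_self]
    · simp [hnc i j hij, hij]
  have hn1 : 1 < n := by
    have := Fin.val_ne_of_ne hij
    omega
  have hg : 2 ^ 2 ≤ (S i ⬝ᵥ S j) ^ 2 := by
    obtain ⟨c, hc⟩ := hS.even_dotProduct hne hij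
    exact sq_le_sq.2 (by rw [abs_two, le_abs]; omega)
  have hcast : ∀ k l, S.map (Int.cast : ℤ → ℝ) k ⬝ᵥ S.map (Int.cast : ℤ → ℝ) l =
      ((S k ⬝ᵥ S l : ℤ) : ℝ) := by
    simp [dotProduct]
  have hle := Matrix.det_sq_le_of_dotProduct_self_eq (S.map (Int.cast : ℤ → ℝ))
    (r := ((n - 1 : ℤ) : ℝ)) (by exact_mod_cast (by omega : (0 : ℤ) < n - 1))
    (fun k => by rw [hcast, hS.dotProduct_self]) hij
  rw [hcast, ← Int.cast_det] at hle
  have hle' : S.det ^ 2 ≤ ((n : ℤ) - 1) ^ (n - 2) * (((n : ℤ) - 1) ^ 2 - (S i ⬝ᵥ S j) ^ 2) := by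
    exact_mod_cast hle
  refine hle'.trans (mul_le_mul_of_nonneg_left (by linarith) (pow_nonneg (by omega) _))
end

section
/- For each positive integer k there exists a Seidel matrix S of order 2k+1 such that ±√(4k−1)·i are eigenvalues of S; equivalently, the matrix S² + (4k−1)·I is singular (det(S² + (4k−1)·I) = 0). -/
open Matrix

/-- The upper-triangular entries of a Seidel matrix in which indices `0` and `1` dominate all later
ones and the remaining indices carry alternating signs. -/
def seidelUpper (i j : ℕ) : ℤ :=
  if i < 2 then 1 else if (i + j) % 2 = 1 then 1 else -1

/-- The skew-symmetric extension of `seidelUpper`. -/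
def seidelEntry (i j : ℕ) : ℤ :=
  if i = j then 0 else if i < j then seidelUpper i j else -seidelUpper j i

theorem sum_seidelEntry_of_lt_two {i : ℕ} (hi : i < 2) (n : ℕ) :
    ∑ j ∈ Finset.range n, seidelEntry i (j + 2) = n := by
  have h : ∀ j ∈ Finset.range n, seidelEntry i (j + 2) = 1 := by
    intro j _
    simp only [seidelEntry, seidelUpper]
    split_ifs <;> omega
  simp [Finset.sum_congr rfl h]

theorem sum_seidelEntry_add_two (p n : ℕ) :
    ∑ j ∈ Finset.range n, seidelEntry (p + 2) (j + 2) =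
      if n ≤ p then (if n % 2 = 0 then 0 else if p % 2 = 1 then -1 else 1)
      else (if p % 2 = 1 then -1 else 0) + if (n + p) % 2 = 0 then 1 else 0 := by
  induction n with
  | zero => simp
  | succ n ih =>
    rw [Finset.sum_range_succ, ih]
    simp only [seidelEntry, seidelUpper]
    split_ifs <;> omega

/-- The alternating block of odd order has zero row sums. -/
theorem sum_seidelEntry_odd {p m : ℕ} (hp : p < 2 * m + 1) :
    ∑ j ∈ Finset.range (2 * m + 1), seidelEntry (p + 2) (j + 2) = 0 := by
  rw [sum_seidelEntry_add_two]
  split_ifs <;> omega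

/-- A function on `ℕ` that is constant from `2` on. -/
def blockVec (a b d : ℤ) : ℕ → ℤ
  | 0 => a
  | 1 => b
  | _ + 2 => d

theorem sum_seidelEntry_mul_blockVec (m : ℕ) (a b d : ℤ) {i : ℕ} (hi : i < 2 * m + 3) :
    ∑ j ∈ Finset.range (2 * m + 3), seidelEntry i j * blockVec a b d j =
      blockVec (b + (2 * m + 1) * d) (-a + (2 * m + 1) * d) (-a - b) i := by
  rw [Finset.sum_range_succ', Finset.sum_range_succ']
  simp only [blockVec, ← Finset.sum_mul, add_assoc, Nat.reduceAdd, zero_add]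
  match i with
  | 0 =>
    rw [sum_seidelEntry_of_lt_two (by norm_num)]
    simp [seidelEntry, seidelUpper]
    ring
  | 1 =>
    rw [sum_seidelEntry_of_lt_two (by norm_num)]
    simp [seidelEntry, seidelUpper]
    ring
  | p + 2 =>
    rw [sum_seidelEntry_odd (by omega)]
    simp [seidelEntry, seidelUpper]
    ring

/-- for every positive integer `k` there is a Seidel matrix `S`
of order `2k + 1` with `±√(4k-1)·i` among its eigenvalues, i.e. such that
`S² + (4k-1)·I` is singular. -/
theorem exists_seidel_with_sqrt_eigenvalue (k : ℕ) (hk : 0 < k) :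
    ∃ S : Matrix (Fin (2 * k + 1)) (Fin (2 * k + 1)) ℤ, IsSeidel S ∧
      (S * S + ((4 * (k : ℤ) - 1) •
        (1 : Matrix (Fin (2 * k + 1)) (Fin (2 * k + 1)) ℤ))).det = 0 := by
  obtain ⟨m, rfl⟩ : ∃ m, k = m + 1 := ⟨k - 1, by omega⟩
  set S : Matrix (Fin (2 * (m + 1) + 1)) (Fin (2 * (m + 1) + 1)) ℤ :=
    Matrix.of fun i j => seidelEntry i j with hS
  have mulVec_block (a b d : ℤ) : S *ᵥ (fun j => blockVec a b d j) =
      fun i : Fin (2 * (m + 1) + 1) =>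
        blockVec (b + (2 * m + 1) * d) (-a + (2 * m + 1) * d) (-a - b) i := by
    ext i
    rw [← sum_seidelEntry_mul_blockVec m a b d (by omega)]
    exact Fin.sum_univ_eq_sum_range (fun j => seidelEntry i j * blockVec a b d j) _
  refine ⟨S, ⟨fun i => ?_, fun i j hij => ?_, ?_⟩, ?_⟩
  · simp [hS, seidelEntry]
  · have hij' : (i : ℕ) ≠ j := fun h => hij (Fin.ext h)
    simp only [hS, Matrix.of_apply, seidelEntry, seidelUpper]
    split_ifs <;> simp_all
  · ext i j
    simp only [hS, Matrix.transpose_apply, Matrix.neg_apply, Matrix.of_apply, seidelEntry]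
    split_ifs <;> omega
  · refine Matrix.exists_mulVec_eq_zero_iff.mp ⟨fun j => blockVec 0 1 1 j, fun h => ?_, ?_⟩
    · simpa [blockVec] using congrFun h ⟨1, by omega⟩
    · rw [Matrix.add_mulVec, ← Matrix.mulVec_mulVec, mulVec_block, mulVec_block,
        Matrix.smul_mulVec, Matrix.one_mulVec]
      ext i
      simp only [Pi.add_apply, Pi.smul_apply, Pi.zero_apply, smul_eq_mul]
      generalize (i : ℕ) = q
      match q with
      | 0 => simp [blockVec]
      | 1 => simp [blockVec]; ring
      | p + 2 => simp [blockVec]; ring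
end
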